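/- arXiv:2304.12565 — 6 statements merged into one kernel-verified Lean document; each statement's English description precedes it below -/
import Mathlib

section
/- Let n be an even positive integer. If G is a connected graph on n vertices with at least C(n-1,2) + 2 edges, then G is 1-extendable, unless G is isomorphic to K_2 ∨ (K_{n-3} ∪ K_1) or to K_3 ∨ 3K_1. -/
open SimpleGraph

/-- The join of two simple graphs: their disjoint union together with all
edges between the two parts. -/
def gJoin {α β : Type*} (G : SimpleGraph α) (H : SimpleGraph β) : SimpleGraph (α ⊕ β) :=
  (G ⊕g H) ⊔ SimpleGraph.fromRel (fun x y => x.isLeft ∧ y.isRight)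

open Classical in
/-- The number of neighbours of `x` inside the finite set `S`. -/
noncomputable def degreeIn {V : Type*} (F : SimpleGraph V) (S : Finset V) (x : V) : ℕ :=
  (S.filter (F.Adj x)).card

/-- The sum of the degrees in the subgraph induced on `S`. -/
noncomputable def degreeSumIn {V : Type*} (F : SimpleGraph V) (S : Finset V) : ℕ :=
  ∑ x ∈ S, degreeIn F S x

section Counting

variable {V : Type*} (F : SimpleGraph V) {S : Finset V} {x y : V}

lemma degreeIn_lt_card (hx : x ∈ S) : degreeIn F S x < S.card := by
  classical
  refine Finset.card_lt_card ⟨Finset.filter_subset _ _, fun h => ?_⟩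
  exact F.irrefl (Finset.mem_filter.1 (h hx)).2

lemma not_adj_of_degreeIn_eq_zero (h : degreeIn F S x = 0) (hy : y ∈ S) : ¬F.Adj x y := by
  classical
  intro ha
  have := Finset.card_eq_zero.1 h
  exact Finset.notMem_empty y (this ▸ Finset.mem_filter.2 ⟨hy, ha⟩)

lemma not_adj_of_degreeSumIn_eq_zero (h : degreeSumIn F S = 0) (hx : x ∈ S) (hy : y ∈ S) :
    ¬F.Adj x y :=
  not_adj_of_degreeIn_eq_zero F (Finset.sum_eq_zero_iff.1 h x hx) hy

variable [DecidableEq V]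

lemma degreeIn_erase_self : degreeIn F (S.erase x) x = degreeIn F S x := by
  classical
  unfold degreeIn
  congr 1
  ext z
  simp only [Finset.mem_filter, Finset.mem_erase]
  exact ⟨fun h => ⟨h.1.2, h.2⟩, fun h => ⟨⟨h.2.ne', h.1⟩, h.2⟩⟩

open Classical in
lemma degreeIn_eq_erase_add (hx : x ∈ S) (y : V) :
    degreeIn F S y = degreeIn F (S.erase x) y + if F.Adj x y then 1 else 0 := by
  unfold degreeIn
  conv_lhs => rw [← Finset.insert_erase hx]
  rw [Finset.filter_insert, F.adj_comm x y]
  split_ifs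
  · rw [Finset.card_insert_of_notMem (by simp)]
  · simp

lemma degreeSumIn_eq_erase_add (hx : x ∈ S) :
    degreeSumIn F S = degreeSumIn F (S.erase x) + 2 * degreeIn F S x := by
  classical
  unfold degreeSumIn
  rw [← Finset.add_sum_erase S _ hx, Finset.sum_congr rfl
    (fun y _ => degreeIn_eq_erase_add F hx y), Finset.sum_add_distrib, ← Finset.card_filter]
  have h : ((S.erase x).filter (fun y => F.Adj x y)).card = degreeIn F S x := degreeIn_erase_self F
  omega

lemma degreeSumIn_eq_erase_erase_add (hx : x ∈ S) (hy : y ∈ S) (hxy : x ≠ y) (h : ¬F.Adj x y) :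
    degreeSumIn F S = degreeSumIn F ((S.erase x).erase y) + 2 * degreeIn F S x
      + 2 * degreeIn F S y := by
  have h1 := degreeSumIn_eq_erase_add F hx
  have h2 := degreeSumIn_eq_erase_add F (Finset.mem_erase.2 ⟨hxy.symm, hy⟩)
  have h3 := degreeIn_eq_erase_add F hx y
  rw [if_neg h] at h3
  omega

lemma exists_not_adj_of_degreeIn_lt (hx : x ∈ S) (h : degreeIn F S x + 1 < S.card) :
    ∃ y ∈ S, x ≠ y ∧ ¬F.Adj x y := by
  classical
  by_contra! hc
  have : S.erase x ⊆ S.filter (F.Adj x) := fun y hy => by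
    obtain ⟨h1, h2⟩ := Finset.mem_erase.1 hy
    exact Finset.mem_filter.2 ⟨h2, hc y h2 h1.symm⟩
  have := Finset.card_le_card this
  rw [Finset.card_erase_of_mem hx] at this
  unfold degreeIn at h
  omega

lemma adj_of_degreeIn_eq (hx : x ∈ S) (h : degreeIn F S x + 1 = S.card) (hy : y ∈ S)
    (hxy : x ≠ y) : F.Adj x y := by
  by_contra hn
  have h1 := degreeIn_eq_erase_add F hy x
  rw [if_neg (by rwa [F.adj_comm])] at h1
  have h2 := degreeIn_lt_card F (Finset.mem_erase.2 ⟨hxy, hx⟩)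
  rw [Finset.card_erase_of_mem hy] at h2
  omega

lemma adj_of_degreeSumIn_eq (h : S.card * (S.card - 1) ≤ degreeSumIn F S) (hx : x ∈ S)
    (hy : y ∈ S) (hxy : x ≠ y) : F.Adj x y := by
  refine adj_of_degreeIn_eq F hx ?_ hy hxy
  have hlt := degreeIn_lt_card F hx
  by_contra hne
  have : degreeSumIn F S < ∑ _z ∈ S, (S.card - 1) :=
    Finset.sum_lt_sum (fun z hz => by have := degreeIn_lt_card F hz; omega) ⟨x, hx, by omega⟩
  rw [Finset.sum_const, smul_eq_mul] at this
  omega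

lemma card_mul_pred_le_degreeSumIn (h : ∀ a ∈ S, ∀ b ∈ S, a ≠ b → F.Adj a b) :
    S.card * (S.card - 1) ≤ degreeSumIn F S := by
  refine Finset.card_nsmul_le_sum _ _ _ fun x hx => ?_
  by_contra hlt
  obtain ⟨z, hz, hxz, hn⟩ := exists_not_adj_of_degreeIn_lt F hx (by omega)
  exact hn (h x hx z hz hxz)

/-- If every non-neighbour of `x` is isolated and `x` has maximum degree, then all edges
lie on the closed neighbourhood of `x`. -/
lemma degreeSumIn_le_of_isolated (hx : x ∈ S)
    (hmax : ∀ y ∈ S, degreeIn F S y ≤ degreeIn F S x)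
    (hiso : ∀ y ∈ S, x ≠ y → ¬F.Adj x y → degreeIn F S y = 0) :
    degreeSumIn F S ≤ degreeIn F S x + degreeIn F S x * degreeIn F S x := by
  classical
  unfold degreeSumIn
  rw [← Finset.add_sum_erase S _ hx]
  gcongr
  rw [← Finset.sum_filter_add_sum_filter_not (S.erase x) (F.Adj x),
    Finset.sum_eq_zero (s := (S.erase x).filter (fun y => ¬F.Adj x y)), add_zero]
  · calc _ ≤ ((S.erase x).filter (F.Adj x)).card • degreeIn F S x :=
        Finset.sum_le_card_nsmul _ _ _ (fun y hy =>
          hmax y (Finset.mem_of_mem_erase (Finset.mem_filter.1 hy).1))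
      _ = _ := by
        rw [smul_eq_mul]
        exact congrArg (· * _) (degreeIn_erase_self F)
  · intro y hy
    obtain ⟨h1, h2⟩ := Finset.mem_filter.1 hy
    obtain ⟨h3, h4⟩ := Finset.mem_erase.1 h1
    exact hiso y h4 h3.symm h2

/-- A sparse graph without a dominating vertex has two non-adjacent vertices of large total
degree, unless it is a triangle together with an isolated vertex. -/
lemma exists_not_adj_degreeIn_large (hcard : 4 ≤ S.card)
    (hsum : degreeSumIn F S + 2 ≤ 2 * S.card) (hdeg : ∀ x ∈ S, degreeIn F S x + 1 < S.card) :
    (∃ x ∈ S, ∃ y ∈ S, x ≠ y ∧ ¬F.Adj x y ∧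
      degreeSumIn F S + 8 ≤ 2 * S.card + 2 * degreeIn F S x + 2 * degreeIn F S y) ∨
    (S.card = 4 ∧ ∃ y ∈ S, degreeIn F S y = 0 ∧
      ∀ a ∈ S.erase y, ∀ b ∈ S.erase y, a ≠ b → F.Adj a b) := by
  obtain ⟨x, hx, hmax⟩ := S.exists_max_image (degreeIn F S) (Finset.card_pos.1 (by omega))
  obtain ⟨y, hy, hxy, hadj⟩ := exists_not_adj_of_degreeIn_lt F hx (hdeg x hx)
  rcases le_or_gt 3 (degreeIn F S x) with h3 | h3
  · exact .inl ⟨x, hx, y, hy, hxy, hadj, by omega⟩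
  by_cases hiso : ∀ z ∈ S, x ≠ z → ¬F.Adj x z → degreeIn F S z = 0
  · have hle := degreeSumIn_le_of_isolated F hx hmax hiso
    have hy0 := hiso y hy hxy hadj
    by_cases hfew : degreeSumIn F S + 8 ≤ 2 * S.card + 2 * degreeIn F S x
    · exact .inl ⟨x, hx, y, hy, hxy, hadj, by omega⟩
    have h6 : S.card = 4 ∧ degreeSumIn F S = 6 := by
      have heven := degreeSumIn_eq_erase_erase_add F hx hy hxy hadj
      generalize degreeIn F S x = d at *
      interval_cases d
      · omega
      · omega
      · have hpar : ∀ T : Finset V, Even (degreeSumIn F T) := fun T => by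
          induction T using Finset.induction_on with
          | empty => simp [degreeSumIn]
          | insert a T ha ih =>
            rw [degreeSumIn_eq_erase_add F (Finset.mem_insert_self a T), Finset.erase_insert ha]
            exact ih.add (even_two_mul _)
        obtain ⟨r, hr⟩ := hpar S
        omega
    refine .inr ⟨h6.1, y, hy, hy0, fun a ha b hb hab => adj_of_degreeSumIn_eq F ?_ ha hb hab⟩
    have := degreeSumIn_eq_erase_add F hy
    rw [Finset.card_erase_of_mem hy, h6.1]
    omega
  · push Not at hiso
    obtain ⟨z, hz, hxz, hadj', hz0⟩ := hiso
    have hzx := hmax z hz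
    rcases Nat.lt_or_ge 1 (degreeIn F S x) with h1 | h1
    · exact .inl ⟨x, hx, z, hz, hxz, hadj', by omega⟩
    · have : degreeSumIn F S ≤ S.card • 1 :=
        Finset.sum_le_card_nsmul _ _ _ (fun w hw => (hmax w hw).trans h1)
      rw [smul_eq_mul, mul_one] at this
      exact .inl ⟨x, hx, z, hz, hxz, hadj', by omega⟩

end Counting

section Matching

variable {V : Type*} (G : SimpleGraph V) {S : Finset V}

lemma adj_of_not_compl_adj {x y : V} (hxy : x ≠ y) (h : ¬Gᶜ.Adj x y) : G.Adj x y := by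
  by_contra hn
  exact h ((compl_adj ..).2 ⟨hxy, hn⟩)

variable [DecidableEq V]

lemma exists_isMatching_of_erase_erase {x y : V} (hx : x ∈ S) (hy : y ∈ S) (h : G.Adj x y)
    (hM : ∃ M : G.Subgraph, M.IsMatching ∧ M.verts = (S.erase x).erase y) :
    ∃ M : G.Subgraph, M.IsMatching ∧ M.verts = S ∧ M.Adj x y := by
  obtain ⟨M, hM, hv⟩ := hM
  refine ⟨M ⊔ G.subgraphOfAdj h, hM.sup (.subgraphOfAdj h) ?_, ?_, ?_⟩
  · rw [hM.support_eq_verts, (Subgraph.IsMatching.subgraphOfAdj h).support_eq_verts, hv,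
      Set.disjoint_left]
    simp only [Finset.coe_erase, subgraphOfAdj_verts]
    grind
  · rw [Subgraph.verts_sup, hv]
    ext z
    simp only [Finset.coe_erase, subgraphOfAdj_verts]
    grind
  · simp

lemma exists_isMatching_of_card_eq_two (hcard : S.card = 2)
    (h : ∀ x ∈ S, ∀ y ∈ S, x ≠ y → G.Adj x y) :
    ∃ M : G.Subgraph, M.IsMatching ∧ M.verts = S := by
  obtain ⟨a, b, hab, rfl⟩ := Finset.card_eq_two.1 hcard
  exact ⟨G.subgraphOfAdj (h a (by simp) b (by simp) hab), .subgraphOfAdj _, by simp⟩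

/-- A set of even size `m` missing fewer than `m - 1` edges has a perfect matching. -/
lemma exists_isMatching_of_degreeSumIn_compl (k : ℕ) (hcard : S.card = 2 * (k + 1))
    (hsum : degreeSumIn Gᶜ S + 4 ≤ 2 * S.card) :
    ∃ M : G.Subgraph, M.IsMatching ∧ M.verts = S := by
  induction k generalizing S with
  | zero =>
    refine exists_isMatching_of_card_eq_two G (by omega) fun x hx y hy hxy => ?_
    exact adj_of_not_compl_adj G hxy (not_adj_of_degreeSumIn_eq_zero Gᶜ (by omega) hx hy)
  | succ k ih =>
    have hdeg : ∀ x ∈ S, degreeIn Gᶜ S x + 1 < S.card := fun x hx => by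
      have := degreeSumIn_eq_erase_add Gᶜ hx
      omega
    rcases exists_not_adj_degreeIn_large Gᶜ (by omega) (by omega) hdeg with
      ⟨x, hx, y, hy, hxy, hadj, hle⟩ | ⟨h4, y, hy, hy0, hclique⟩
    · have h2 := degreeSumIn_eq_erase_erase_add Gᶜ hx hy hxy hadj
      have hc : ((S.erase x).erase y).card = S.card - 2 := by
        rw [Finset.card_erase_of_mem (Finset.mem_erase.2 ⟨hxy.symm, hy⟩),
          Finset.card_erase_of_mem hx]
        omega
      obtain ⟨M, hM, hv, -⟩ := exists_isMatching_of_erase_erase G hx hy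
        (adj_of_not_compl_adj G hxy hadj) (ih (by omega) (by omega))
      exact ⟨M, hM, hv⟩
    · have h3 : (S.erase y).card = 3 := by rw [Finset.card_erase_of_mem hy]; omega
      have hle := card_mul_pred_le_degreeSumIn Gᶜ hclique
      have hadd := degreeSumIn_eq_erase_add Gᶜ hy
      rw [h3] at hle
      omega

/-- A set of even size `m` missing at most `m - 1` edges has a perfect matching, unless the
missing edges form a spanning star, or a triangle with `m = 4`. -/
lemma exists_isMatching_or_star_or_triangle (k : ℕ) (hcard : S.card = 2 * (k + 1))
    (hsum : degreeSumIn Gᶜ S + 2 ≤ 2 * S.card) :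
    (∃ M : G.Subgraph, M.IsMatching ∧ M.verts = S) ∨
    (∃ w ∈ S, degreeIn Gᶜ S w + 1 = S.card) ∨
    (S.card = 4 ∧ ∃ y ∈ S, degreeIn Gᶜ S y = 0 ∧
      ∀ a ∈ S.erase y, ∀ b ∈ S.erase y, a ≠ b → Gᶜ.Adj a b) := by
  by_cases hstar : ∃ w ∈ S, degreeIn Gᶜ S w + 1 = S.card
  · exact .inr (.inl hstar)
  push Not at hstar
  have hdeg : ∀ x ∈ S, degreeIn Gᶜ S x + 1 < S.card := fun x hx => by
    have := degreeIn_lt_card Gᶜ hx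
    have := hstar x hx
    omega
  rcases k with _ | k
  · refine .inl (exists_isMatching_of_card_eq_two G (by omega) fun x hx y hy hxy => ?_)
    exact adj_of_not_compl_adj G hxy
      (not_adj_of_degreeIn_eq_zero Gᶜ (by have := hdeg x hx; omega) hy)
  rcases exists_not_adj_degreeIn_large Gᶜ (by omega) hsum hdeg with
    ⟨x, hx, y, hy, hxy, hadj, hle⟩ | htri
  · have h2 := degreeSumIn_eq_erase_erase_add Gᶜ hx hy hxy hadj
    have hc : ((S.erase x).erase y).card = S.card - 2 := by
      rw [Finset.card_erase_of_mem (Finset.mem_erase.2 ⟨hxy.symm, hy⟩),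
        Finset.card_erase_of_mem hx]
      omega
    obtain ⟨M, hM, hv, -⟩ := exists_isMatching_of_erase_erase G hx hy
      (adj_of_not_compl_adj G hxy hadj)
      (exists_isMatching_of_degreeSumIn_compl G k (by omega) (by omega))
    exact .inl ⟨M, hM, hv⟩
  · exact .inr (.inr htri)

end Matching

lemma degreeSumIn_univ {V : Type*} [Fintype V] [DecidableEq V] (F : SimpleGraph V) :
    degreeSumIn F Finset.univ = 2 * F.edgeSet.ncard := by
  classical
  rw [← F.coe_edgeFinset, Set.ncard_coe_finset, ← F.sum_degrees_eq_twice_card_edges]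
  refine Finset.sum_congr rfl fun x _ => ?_
  rw [← F.card_neighborFinset_eq_degree, F.neighborFinset_eq_filter]
  unfold degreeIn
  congr!

lemma ncard_edgeSet_add_compl {V : Type*} [Fintype V] (G : SimpleGraph V) :
    G.edgeSet.ncard + Gᶜ.edgeSet.ncard = (Fintype.card V).choose 2 := by
  classical
  rw [← Set.ncard_union_eq (disjoint_edgeSet.2 disjoint_compl_right), ← edgeSet_sup,
    sup_compl_eq_top, ← coe_edgeFinset, Set.ncard_coe_finset,
    card_edgeFinset_top_eq_card_choose_two]

lemma exists_equiv_of_card_fibers_eq {α β γ : Type*} [Fintype α] [Fintype β] [DecidableEq γ]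
    (f : α → γ) (g : β → γ)
    (h : ∀ c, (Finset.univ.filter (f · = c)).card = (Finset.univ.filter (g · = c)).card) :
    ∃ e : α ≃ β, ∀ a, g (e a) = f a := by
  have key : ∀ c, Nonempty ({a // f a = c} ≃ {b // g b = c}) := fun c =>
    Fintype.card_eq.1 (by rw [Fintype.card_subtype, Fintype.card_subtype, h c])
  let e := fun c => (key c).some
  refine ⟨(Equiv.sigmaFiberEquiv f).symm.trans
    ((Equiv.sigmaCongrRight e).trans (Equiv.sigmaFiberEquiv g)), fun a => ?_⟩
  exact (e (f a) ⟨a, rfl⟩).2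

lemma gJoin_adj_inl_inl {α β : Type*} (G : SimpleGraph α) (H : SimpleGraph β) (a b : α) :
    (gJoin G H).Adj (.inl a) (.inl b) ↔ G.Adj a b := by
  simp [gJoin]

lemma gJoin_adj_inr_inr {α β : Type*} (G : SimpleGraph α) (H : SimpleGraph β) (a b : β) :
    (gJoin G H).Adj (.inr a) (.inr b) ↔ H.Adj a b := by
  simp [gJoin]

lemma gJoin_adj_inl_inr {α β : Type*} (G : SimpleGraph α) (H : SimpleGraph β) (a : α) (b : β) :
    (gJoin G H).Adj (.inl a) (.inr b) := by
  simp [gJoin]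

lemma gJoin_adj_inr_inl {α β : Type*} (G : SimpleGraph α) (H : SimpleGraph β) (a : α) (b : β) :
    (gJoin G H).Adj (.inr b) (.inl a) :=
  (gJoin_adj_inl_inr G H a b).symm

/-- Recognition of `K_2 ∨ (K_{n-3} ∪ K_1)`. -/
lemma nonempty_iso_gJoin_star {n : ℕ} (G : SimpleGraph (Fin n)) {u v w : Fin n}
    (huv : u ≠ v) (huw : u ≠ w) (hvw : v ≠ w)
    (hG : ∀ a b, G.Adj a b ↔ a ≠ b ∧ (a = u ∨ a = v ∨ b = u ∨ b = v ∨ (a ≠ w ∧ b ≠ w))) :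
    Nonempty (G ≃g gJoin (⊤ : SimpleGraph (Fin 2))
      ((⊤ : SimpleGraph (Fin (n - 3))) ⊕g (⊤ : SimpleGraph (Fin 1)))) := by
  let f : Fin n → Fin 3 := fun a => if a = u ∨ a = v then 0 else if a = w then 2 else 1
  let g : Fin 2 ⊕ (Fin (n - 3) ⊕ Fin 1) → Fin 3 :=
    Sum.elim (fun _ => 0) (Sum.elim (fun _ => 1) (fun _ => 2))
  have hf0 : Finset.univ.filter (f · = 0) = {u, v} := by ext a; simp [f]; grind
  have hf1 : Finset.univ.filter (f · = 1) = {u, v, w}ᶜ := by ext a; simp [f]; grind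
  have hf2 : Finset.univ.filter (f · = 2) = {w} := by ext a; simp [f]; grind
  obtain ⟨e, he⟩ := exists_equiv_of_card_fibers_eq f g fun c => by
    rw [Finset.card_filter (g · = c), Fintype.sum_sum_type, Fintype.sum_sum_type]
    obtain rfl | rfl | rfl : c = 0 ∨ c = 1 ∨ c = 2 := by fin_cases c <;> simp
    · simp [hf0, huv, g]
    · simp [hf1, huv, huw, hvw, Finset.card_compl, g]
      omega
    · simp [hf2, g]
  have hg : ∀ x y, (gJoin (⊤ : SimpleGraph (Fin 2))
      ((⊤ : SimpleGraph (Fin (n - 3))) ⊕g (⊤ : SimpleGraph (Fin 1)))).Adj x y ↔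
      x ≠ y ∧ (g x = 0 ∨ g y = 0 ∨ (g x = 1 ∧ g y = 1)) := by
    rintro (x | x | x) (y | y | y) <;>
      simp [gJoin_adj_inl_inl, gJoin_adj_inl_inr, gJoin_adj_inr_inl, gJoin_adj_inr_inr, g]
    all_goals exact Subsingleton.elim _ _
  refine ⟨⟨e, fun {a b} => ?_⟩⟩
  rw [hg, hG, he, he, e.injective.ne_iff]
  simp only [f]
  grind

/-- Recognition of `K_3 ∨ 3K_1`. -/
lemma nonempty_iso_gJoin_triangle {n : ℕ} (hn : n = 6) (G : SimpleGraph (Fin n)) {u v y : Fin n}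
    (huv : u ≠ v) (huy : u ≠ y) (hvy : v ≠ y)
    (hG : ∀ a b, G.Adj a b ↔ a ≠ b ∧ (a ∈ ({u, v, y} : Finset (Fin n)) ∨
      b ∈ ({u, v, y} : Finset (Fin n)))) :
    Nonempty (G ≃g gJoin (⊤ : SimpleGraph (Fin 3)) (⊥ : SimpleGraph (Fin 3))) := by
  let f : Fin n → Bool := fun a => decide (a ∈ ({u, v, y} : Finset (Fin n)))
  let g : Fin 3 ⊕ Fin 3 → Bool := Sum.isLeft
  have hf1 : Finset.univ.filter (f · = true) = {u, v, y} := by ext a; simp [f]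
  have hf0 : Finset.univ.filter (f · = false) = {u, v, y}ᶜ := by ext a; simp [f]
  obtain ⟨e, he⟩ := exists_equiv_of_card_fibers_eq f g fun c => by
    rw [Finset.card_filter (g · = c), Fintype.sum_sum_type]
    cases c
    · simp [hf0, huv, huy, hvy, Finset.card_compl, g, hn]
    · simp [hf1, huv, huy, hvy, g]
  have hg : ∀ a b, (gJoin (⊤ : SimpleGraph (Fin 3)) (⊥ : SimpleGraph (Fin 3))).Adj a b ↔
      a ≠ b ∧ (g a = true ∨ g b = true) := by
    rintro (a | a) (b | b) <;>
      simp [gJoin_adj_inl_inl, gJoin_adj_inl_inr, gJoin_adj_inr_inl, gJoin_adj_inr_inr, g]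
  refine ⟨⟨e, fun {a b} => ?_⟩⟩
  rw [hg, hG, he, he, e.injective.ne_iff]
  simp only [f, decide_eq_true_eq]

theorem size_one_extendable (n : ℕ) (hn : 0 < n) (hnev : Even n)
    (G : SimpleGraph (Fin n)) (hconn : G.Connected)
    (hsize : (n - 1).choose 2 + 2 ≤ G.edgeSet.ncard) :
    (∀ e ∈ G.edgeSet, ∃ P : G.Subgraph, P.IsPerfectMatching ∧ e ∈ P.edgeSet) ∨
    Nonempty (G ≃g gJoin (⊤ : SimpleGraph (Fin 2))
      ((⊤ : SimpleGraph (Fin (n - 3))) ⊕g (⊤ : SimpleGraph (Fin 1)))) ∨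
    Nonempty (G ≃g gJoin (⊤ : SimpleGraph (Fin 3)) (⊥ : SimpleGraph (Fin 3))) := by
  by_cases hext : ∀ e ∈ G.edgeSet, ∃ P : G.Subgraph, P.IsPerfectMatching ∧ e ∈ P.edgeSet
  · exact .inl hext
  right
  push Not at hext
  obtain ⟨e, he, hP⟩ := hext
  induction e using Sym2.ind with
  | _ u v =>
  rw [mem_edgeSet] at he
  have huv := he.ne
  have hnadj : ¬Gᶜ.Adj u v := fun h => ((compl_adj ..).1 h).2 he
  obtain ⟨m, rfl⟩ : ∃ m, n = m + 1 := ⟨n - 1, by omega⟩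
  have hcount := ncard_edgeSet_add_compl G
  rw [Fintype.card_fin, Nat.choose_succ_succ' m 1, Nat.choose_one_right,
    one_add_one_eq_two] at hcount
  rw [Nat.add_sub_cancel] at hsize
  set S : Finset (Fin (m + 1)) := (Finset.univ.erase u).erase v with hS
  have hmem : ∀ a, a ∈ S ↔ a ≠ v ∧ a ≠ u := fun a => by simp [hS]
  have hScard : S.card = m + 1 - 2 := by
    rw [hS, Finset.card_erase_of_mem (by simpa using huv.symm),
      Finset.card_erase_of_mem (Finset.mem_univ _), Finset.card_univ, Fintype.card_fin]
    omega
  have hsum := degreeSumIn_eq_erase_erase_add Gᶜ (Finset.mem_univ u) (Finset.mem_univ v) huv hnadj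
  rw [degreeSumIn_univ, ← hS] at hsum
  obtain ⟨j, hj⟩ := hnev
  obtain ⟨k, rfl⟩ : ∃ k, j = k + 2 := ⟨j - 2, by omega⟩
  have hisolated : 2 * S.card ≤ degreeSumIn Gᶜ S + 2 →
      ∀ a, (a = u ∨ a = v) → ∀ b, ¬Gᶜ.Adj a b := by
    rintro hle a (rfl | rfl) b
    all_goals exact not_adj_of_degreeIn_eq_zero (S := Finset.univ) Gᶜ (by omega) (Finset.mem_univ b)
  rcases exists_isMatching_or_star_or_triangle G (S := S) k (by omega) (by omega) with
    hM | ⟨w, hw, hwdeg⟩ | ⟨h4, y, hy, hy0, hclique⟩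
  · obtain ⟨M, hM, hv, hadj⟩ := exists_isMatching_of_erase_erase G (Finset.mem_univ u)
      (Finset.mem_univ v) he hM
    exact absurd (Subgraph.mem_edgeSet.2 hadj) (hP M ⟨hM, fun x => by simp [hv]⟩)
  · left
    have hsw := degreeSumIn_eq_erase_add Gᶜ hw
    have hiso := hisolated (by omega)
    have hzero : degreeSumIn Gᶜ (S.erase w) = 0 := by omega
    have hrest := fun {a b} => not_adj_of_degreeSumIn_eq_zero Gᶜ (x := a) (y := b) hzero
    have hstar := fun {b} => adj_of_degreeIn_eq Gᶜ (y := b) hw hwdeg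
    have hw' := (hmem w).1 hw
    refine nonempty_iso_gJoin_star G huv hw'.2.symm hw'.1.symm fun a b => ?_
    simp only [compl_adj, Finset.mem_erase, hmem] at hiso hrest hstar
    have hs := G.adj_comm a b
    have hne : G.Adj a b → a ≠ b := fun h => h.ne
    grind
  · right
    have hadd := degreeSumIn_eq_erase_add Gᶜ hy
    have h3 : (S.erase y).card = 3 := by rw [Finset.card_erase_of_mem hy, h4]
    have h6 := card_mul_pred_le_degreeSumIn Gᶜ hclique
    rw [h3] at h6
    have hiso := hisolated (by omega)
    have hyiso := fun {b} => not_adj_of_degreeIn_eq_zero Gᶜ (y := b) hy0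
    have hy' := (hmem y).1 hy
    refine nonempty_iso_gJoin_triangle (by omega) G huv hy'.2.symm hy'.1.symm fun a b => ?_
    simp only [compl_adj, Finset.mem_erase, hmem] at hiso hyiso hclique
    have hs := G.adj_comm a b
    have hne : G.Adj a b → a ≠ b := fun h => h.ne
    simp only [Finset.mem_insert, Finset.mem_singleton]
    grind
end

section
/- Let n ≥ 10 be an even integer and G a connected graph on n vertices with minimum degree at least 2. If G has at least C(n-2,2) + 3 edges, then for every edge e of G there exists a perfect matching of G not containing e, unless G is isomorphic to K_4 ∨ (K_2 ∪ 4K_1) or to K_1 ∨ (K_2 ∪ K_{n-3}). -/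
open SimpleGraph

/-- `G` is `1`-excludable: for every edge `e` of `G` there is a perfect
matching of `G` avoiding `e`. -/
def oneExcludable {V : Type*} (G : SimpleGraph V) : Prop :=
  ∀ e ∈ G.edgeSet, ∃ P : G.Subgraph, P.IsPerfectMatching ∧ e ∉ P.edgeSet

open Finset

/-- The ordered pairs of distinct non-adjacent vertices and the ordered pairs of adjacent vertices
make up all ordered pairs of distinct vertices. -/
lemma card_nonadj_add_two_mul_ncard_edgeSet {V : Type*} [Fintype V] [DecidableEq V]
    (H : SimpleGraph V) [DecidableRel H.Adj] :
    #{p : V × V | p.1 ≠ p.2 ∧ ¬ H.Adj p.1 p.2} + 2 * H.edgeSet.ncard + Fintype.card V =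
      Fintype.card V * Fintype.card V := by
  have h1 := Finset.card_filter_add_card_filter_not (s := (univ : Finset V).offDiag)
    (fun p => H.Adj p.1 p.2)
  have h2 : H.edgeSet.ncard = #H.edgeFinset := by
    rw [← SimpleGraph.coe_edgeFinset, Set.ncard_coe_finset]
  have h3 : (univ : Finset V).offDiag.filter (fun p => H.Adj p.1 p.2) =
      univ.filter fun (x, y) ↦ H.Adj x y := by
    ext ⟨x, y⟩
    simpa using fun h => H.ne_of_adj h
  have h4 : (univ : Finset V).offDiag.filter (fun p => ¬ H.Adj p.1 p.2) =
      univ.filter fun p : V × V => p.1 ≠ p.2 ∧ ¬ H.Adj p.1 p.2 := by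
    ext ⟨x, y⟩
    simp
  rw [h3, h4, ← two_mul_card_edgeFinset, offDiag_card, card_univ] at h1
  have := Nat.le_mul_self (Fintype.card V)
  omega

/-- A graph of even order without perfect matching has a set `S` of vertices and representatives
`R` of `#S + 2` components of the graph without `S`. The map `c` sends each vertex outside `S`
to a representative of its component. -/
lemma exists_separating_of_not_isPerfectMatching {V : Type*} [Fintype V] [DecidableEq V]
    (H : SimpleGraph V) (hV : Even (Fintype.card V))
    (hH : ¬ ∃ M : H.Subgraph, M.IsPerfectMatching) :
    ∃ (S R : Finset V) (c : V → V), #R = #S + 2 ∧ Disjoint S R ∧ (∀ r ∈ R, c r = r) ∧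
      ∀ x y, H.Adj x y → x ∉ S → y ∉ S → c x = c y := by
  classical
  rw [tutte] at hH
  push Not at hH
  obtain ⟨u, hu⟩ := hH
  rw [IsTutteViolator] at hu
  set K := ((⊤ : H.Subgraph).deleteVerts u).coe with hK
  have hmem (x : V) (hx : x ∉ u) : x ∈ ((⊤ : H.Subgraph).deleteVerts u).verts := by simp [hx]
  have hodd := odd_ncard_oddComponents (G := K)
  have hcard : Nat.card ((⊤ : H.Subgraph).deleteVerts u).verts + u.ncard = Fintype.card V := by
    have h1 : ((⊤ : H.Subgraph).deleteVerts u).verts = uᶜ := by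
      ext x; simp
    rw [Nat.card_coe_set_eq, h1, add_comm, Set.ncard_add_ncard_compl, Nat.card_eq_fintype_card]
  have hle : u.ncard + 2 ≤ K.oddComponents.ncard := by
    rcases hV with ⟨m, hm⟩
    by_contra! h
    have h2 : K.oddComponents.ncard = u.ncard + 1 := by omega
    rw [h2, Nat.odd_iff, Nat.odd_iff] at hodd
    omega
  obtain ⟨T, -, hTcard⟩ := Set.exists_subset_card_eq hle
  choose rep hrep using fun C : K.ConnectedComponent => C.exists_rep
  have hinj : Function.Injective fun C => (rep C : V) := by
    intro C D h
    have := Subtype.val_injective h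
    rw [← hrep C, ← hrep D, this]
  refine ⟨u.toFinset, T.toFinset.image fun C => (rep C : V),
    fun x => if h : x ∈ u then x else (rep (K.connectedComponentMk ⟨x, hmem x h⟩) : V),
    ?_, ?_, ?_, ?_⟩
  · rw [card_image_of_injective _ hinj, ← Set.ncard_eq_toFinset_card', hTcard,
      ← Set.ncard_eq_toFinset_card']
  · rw [Finset.disjoint_left]
    intro x hx hx'
    simp only [mem_image] at hx'
    obtain ⟨C, -, rfl⟩ := hx'
    have := (rep C).2
    simp at this hx
    exact this hx
  · intro r hr
    simp only [mem_image] at hr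
    obtain ⟨C, -, rfl⟩ := hr
    have h1 : (rep C : V) ∉ u := by
      have := (rep C).2
      simpa using this
    have h2 : K.connectedComponentMk (rep C) = C := hrep C
    simp [h1, h2]
  · intro x y hxy hx hy
    simp only [Set.mem_toFinset] at hx hy
    have : K.connectedComponentMk ⟨x, hmem x hx⟩ = K.connectedComponentMk ⟨y, hmem y hy⟩ := by
      apply ConnectedComponent.sound
      apply Adj.reachable
      simp [hK, hx, hy, hxy]
    simp [hx, hy, this]

/-- The number of ordered pairs with an entry in `R` which are separated by `c` outside `S`. -/
lemma le_card_separated {V : Type*} [Fintype V] [DecidableEq V] (S R : Finset V) (c : V → V)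
    (hR : #R = #S + 2) (hSR : Disjoint S R) (hc : ∀ r ∈ R, c r = r) :
    (#S + 1) * (2 * Fintype.card V) ≤
      #{p : V × V | (p.1 ∈ R ∨ p.2 ∈ R) ∧ p.1 ∉ S ∧ p.2 ∉ S ∧ c p.1 ≠ c p.2} +
        (#S + 1) * (3 * #S + 2) := by
  set D := univ.filter
    fun p : V × V => (p.1 ∈ R ∨ p.2 ∈ R) ∧ p.1 ∉ S ∧ p.2 ∉ S ∧ c p.1 ≠ c p.2
  set W := (S ∪ R)ᶜ with hW
  have hWcard : #W + (2 * #S + 2) = Fintype.card V := by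
    have := card_compl_add_card (S ∪ R)
    rw [← hW, card_union_of_disjoint hSR] at this
    omega
  set T := (R ×ˢ W).filter fun p => ¬ p.1 = c p.2 with hT
  have hTcard : #R * #W ≤ #W + #T := by
    rw [← card_product, ← card_filter_add_card_filter_not (s := R ×ˢ W) (fun p => p.1 = c p.2)]
    gcongr
    refine card_le_card_of_injOn Prod.snd (by simp +contextual [Set.MapsTo]) ?_
    rintro ⟨a, b⟩ h ⟨a', b'⟩ h' hb
    simp at h h' hb
    grind
  have hRS (r) (hr : r ∈ R) : r ∉ S := fun h => Finset.disjoint_left.1 hSR h hr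
  have hsub : (R.offDiag ∪ T) ∪ T.image Prod.swap ⊆ D := by
    rintro ⟨x, y⟩ h
    simp only [hT, hW, D, mem_union, mem_offDiag, mem_filter, mem_product, mem_image, mem_compl,
      Prod.exists, Prod.swap_prod_mk, Prod.mk.injEq, mem_univ] at h ⊢
    grind
  have hd1 : Disjoint R.offDiag T := by
    rw [Finset.disjoint_left]
    rintro ⟨x, y⟩ h h'
    simp only [hT, hW, mem_union, mem_offDiag, mem_filter, mem_product, mem_compl] at h h'
    grind
  have hd2 : Disjoint (R.offDiag ∪ T) (T.image Prod.swap) := by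
    rw [Finset.disjoint_left]
    rintro ⟨x, y⟩ h h'
    simp only [hT, hW, mem_union, mem_offDiag, mem_filter, mem_product, mem_image, mem_compl,
      Prod.exists, Prod.swap_prod_mk, Prod.mk.injEq] at h h'
    grind
  have := card_le_card hsub
  rw [card_union_of_disjoint hd2, card_union_of_disjoint hd1, offDiag_card,
    card_image_of_injective _ Prod.swap_injective] at this
  have h5 : #R * #R - #R = (#S + 2) * (#S + 1) := by
    rw [hR, Nat.sub_eq_iff_eq_add (Nat.le_mul_self _)]; ring
  rw [h5] at this
  rw [hR] at hTcard
  rw [← hWcard]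
  nlinarith

/-- A graph whose adjacency is determined by the partition of its vertices into `A`, `B` and the
rest, as in a join `K_a ∨ (K_2 ∪ X)` with `X` complete or empty, is isomorphic to that join. -/
lemma nonempty_iso_gJoin {V : Type*} [Fintype V] [DecidableEq V] (G : SimpleGraph V)
    (A B : Finset V) (hAB : Disjoint A B) {a b : ℕ} (X : SimpleGraph (Fin b)) (t : Prop)
    (hX : ∀ i j, X.Adj i j ↔ i ≠ j ∧ t) (hA : #A = a) (hB : #B = 2)
    (hV : Fintype.card V = a + 2 + b)
    (hG : ∀ x y, G.Adj x y ↔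
      x ≠ y ∧ (x ∈ A ∨ y ∈ A ∨ (x ∈ B ∧ y ∈ B) ∨ (x ∉ B ∧ y ∉ B ∧ t))) :
    Nonempty (G ≃g gJoin (⊤ : SimpleGraph (Fin a)) ((⊤ : SimpleGraph (Fin 2)) ⊕g X)) := by
  have hC : #(A ∪ B)ᶜ = b := by
    have := card_compl_add_card (A ∪ B)
    rw [card_union_of_disjoint hAB] at this
    omega
  let e₁ : {x // x ∈ A} ≃ Fin a := A.equivFinOfCardEq hA
  let e₂ : {x // x ∈ B} ≃ Fin 2 := B.equivFinOfCardEq hB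
  let e₃ : {x // x ∈ (A ∪ B)ᶜ} ≃ Fin b := (A ∪ B)ᶜ.equivFinOfCardEq hC
  let f : Fin a ⊕ (Fin 2 ⊕ Fin b) → V :=
    Sum.elim (fun i => e₁.symm i) (Sum.elim (fun i => e₂.symm i) (fun i => e₃.symm i))
  have m₁ (i) : (e₁.symm i : V) ∈ A := (e₁.symm i).2
  have m₂ (i) : (e₂.symm i : V) ∈ B := (e₂.symm i).2
  have m₃ (i) : (e₃.symm i : V) ∉ A ∧ (e₃.symm i : V) ∉ B := by simpa using (e₃.symm i).2
  have m₂' (i) : (e₂.symm i : V) ∉ A := fun h => Finset.disjoint_left.1 hAB h (m₂ i)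
  have hf : Function.Injective f := by
    rintro (i | i | i) (j | j | j) h <;> simp only [f, Sum.elim_inl, Sum.elim_inr] at h
    · simpa [Subtype.ext_iff] using h
    · exact absurd (h ▸ m₁ i) (m₂' j)
    · exact absurd (h ▸ m₁ i) (m₃ j).1
    · exact absurd (h ▸ m₁ j) (m₂' i)
    · simpa using Subtype.ext h
    · exact absurd (h ▸ m₂ i) (m₃ j).2
    · exact absurd (h ▸ m₁ j) (m₃ i).1
    · exact absurd (h ▸ m₂ j) (m₃ i).2
    · simpa using Subtype.ext h
  have hbij : Function.Bijective f := by
    rw [Fintype.bijective_iff_injective_and_card]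
    refine ⟨hf, ?_⟩
    simp [hV]; ring
  refine ⟨(RelIso.mk (Equiv.ofBijective f hbij) ?_).symm⟩
  intro x y
  rw [Equiv.ofBijective_apply, Equiv.ofBijective_apply, hG, hf.ne_iff]
  rcases x with (i | i | i) <;> rcases y with (j | j | j) <;>
    simp [f, gJoin, m₁, m₂, m₂', m₃, hX]

/-- The numerical heart of the argument: few non-adjacent pairs force a small separating set. -/
lemma separator_size_cases {n s : ℕ} (hn : 10 ≤ n) (hs : 2 * s + 2 ≤ n)
    (h : (s + 1) * (2 * n) + 10 ≤ 4 * n + (s + 1) * (3 * s + 2)) :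
    s = 0 ∨ s = 1 ∨ (s = 4 ∧ n = 10) := by
  obtain ⟨t, rfl⟩ := Nat.exists_eq_add_of_le hs
  by_contra! hne
  obtain ⟨j, rfl⟩ : ∃ j, s = j + 2 := ⟨s - 2, by omega⟩
  have h1 : j + 2 * t ≤ 2 := by
    by_contra! h2
    nlinarith
  have : j ≤ 2 := by omega
  interval_cases j <;> omega

/-- The structure of a graph with many edges and minimum degree at least two in which some edge
`ab` lies in every perfect matching. -/
lemma exists_partition_of_not_isPerfectMatching {V : Type*} [Fintype V] [DecidableEq V]
    (G : SimpleGraph V) (hn : 10 ≤ Fintype.card V) (hnev : Even (Fintype.card V))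
    (hdeg : ∀ v, 2 ≤ (G.neighborSet v).ncard)
    (hsize : (Fintype.card V - 2).choose 2 + 3 ≤ G.edgeSet.ncard) {a b : V} (hab : G.Adj a b)
    (hM : ¬ ∃ M : (G.deleteEdges {s(a, b)}).Subgraph, M.IsPerfectMatching) :
    ∃ A B : Finset V, Disjoint A B ∧ #B = 2 ∧ ∃ t : Prop,
      ((#A = 4 ∧ Fintype.card V = 10 ∧ ¬ t) ∨ (#A = 1 ∧ t)) ∧
      ∀ x y, G.Adj x y ↔
        x ≠ y ∧ (x ∈ A ∨ y ∈ A ∨ (x ∈ B ∧ y ∈ B) ∨ (x ∉ B ∧ y ∉ B ∧ t)) := by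
  classical
  set H := G.deleteEdges {s(a, b)} with hH
  have hadj (x y) : H.Adj x y ↔ G.Adj x y ∧ ¬ s(x, y) = s(a, b) := by simp [hH]
  have hGadj (x y) : G.Adj x y ↔ H.Adj x y ∨ s(x, y) = s(a, b) := by
    rw [hadj]
    constructor
    · tauto
    · rintro (h | h)
      · exact h.1
      · rwa [← mem_edgeSet, h]
  have hHab : ¬ H.Adj a b := by simp [hadj]
  have hedges : H.edgeSet.ncard + 1 = G.edgeSet.ncard := by
    rw [hH, edgeSet_deleteEdges]
    exact Set.ncard_sdiff_singleton_add_one hab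
  have hnbr (x z : V) : ∃ y, y ≠ z ∧ G.Adj x y := by
    obtain ⟨y, hy, hyz⟩ := Set.exists_ne_of_one_lt_ncard (hdeg x) z
    exact ⟨y, hyz, hy⟩
  obtain ⟨S, R, c, hR, hSR, hcR, hc⟩ := exists_separating_of_not_isPerfectMatching H hnev hM
  have hcount := card_nonadj_add_two_mul_ncard_edgeSet H
  have hDcard := le_card_separated S R c hR hSR hcR
  have hSRcard := card_compl_add_card (S ∪ R)
  rw [card_union_of_disjoint hSR, hR] at hSRcard
  have hRS (r) (hr : r ∈ R) : r ∉ S := fun h => Finset.disjoint_left.1 hSR h hr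
  set P := univ.filter fun p : V × V => p.1 ≠ p.2 ∧ ¬ H.Adj p.1 p.2 with hP
  set D := univ.filter
    fun p : V × V => (p.1 ∈ R ∨ p.2 ∈ R) ∧ p.1 ∉ S ∧ p.2 ∉ S ∧ c p.1 ≠ c p.2 with hD
  have hDP : D ⊆ P := by
    rintro ⟨x, y⟩
    simp only [hD, hP, mem_filter, mem_univ, true_and]
    rintro ⟨-, hx, hy, hxy⟩
    exact ⟨fun h => hxy (h ▸ rfl), fun h => hxy (hc x y h hx hy)⟩
  have hPcard : #P + 10 ≤ 4 * Fintype.card V := by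
    obtain ⟨k, hk⟩ := Nat.exists_eq_add_of_le hn
    have h2 : Fintype.card V - 2 = k + 7 + 1 := by omega
    have h3 : (k + 7 + 1).choose 2 * 2 = (k + 8) * (k + 7) := by
      rw [Nat.choose_two_right, Nat.div_mul_cancel]
      · rfl
      · exact (Nat.even_mul_pred_self _).two_dvd
    rw [h2] at hsize
    rw [hk] at hcount ⊢
    nlinarith
  have hle := card_le_card hDP
  have hexact (h : #P ≤ #D) (x y : V) (hxy : x ≠ y) :
      H.Adj x y ↔ ¬ ((x ∈ R ∨ y ∈ R) ∧ x ∉ S ∧ y ∉ S ∧ c x ≠ c y) := by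
    have := Finset.ext_iff.1 (eq_of_subset_of_card_le hDP h) (x, y)
    simp only [hD, hP, mem_filter, mem_univ, true_and] at this
    tauto
  have hcases := separator_size_cases (s := #S) hn (by omega) (by linarith)
  rcases hcases with h0 | h1 | ⟨h4, h10⟩
  · exfalso
    obtain rfl : S = ∅ := card_eq_zero.1 h0
    have hHnbr (x : V) : ∃ y, H.Adj x y := by
      obtain ⟨y, hy, hxy⟩ := hnbr x (if x = a then b else a)
      refine ⟨y, (hadj x y).2 ⟨hxy, ?_⟩⟩
      rw [Sym2.eq_iff]
      grind
    obtain ⟨r₁, r₂, hr, rfl⟩ := card_eq_two.1 hR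
    set A := univ.filter fun x => c x = r₁ with hA
    set B := univ.filter fun x => ¬ c x = r₁ with hB
    have hABcard : #A + #B = Fintype.card V := card_filter_add_card_filter_not _
    have hA2 : 1 < #A := by
      obtain ⟨y, hy⟩ := hHnbr r₁
      have := hc _ _ hy (by simp) (by simp)
      exact one_lt_card.2 ⟨r₁, by simp [hA, hcR], y, by simp [hA, hcR, ← this], hy.ne⟩
    have hB2 : 1 < #B := by
      obtain ⟨y, hy⟩ := hHnbr r₂
      have := hc _ _ hy (by simp) (by simp)
      exact one_lt_card.2 ⟨r₂, by simp [hB, hcR, hr.symm], y,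
        by simp [hB, hcR, ← this, hr.symm], hy.ne⟩
    have hsub : A ×ˢ B ∪ B ×ˢ A ⊆ P := by
      rintro ⟨x, y⟩
      simp only [hA, hB, hP, mem_filter, mem_univ, true_and, mem_union, mem_product]
      intro h
      have h1 : ¬ c x = c y := by grind
      exact ⟨fun h => h1 (h ▸ rfl), fun h => h1 (hc x y h (by simp) (by simp))⟩
    have hcard := card_le_card hsub
    have hdisj : Disjoint (A ×ˢ B) (B ×ˢ A) := by
      rw [Finset.disjoint_left]
      rintro ⟨x, y⟩
      simp only [hA, hB, mem_filter, mem_univ, true_and, mem_product]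
      tauto
    rw [card_union_of_disjoint hdisj, card_product, card_product] at hcard
    nlinarith
  · rw [h1] at hDcard hR
    have hex := hexact (by omega)
    obtain ⟨v, rfl⟩ := card_eq_one.1 h1
    simp only [mem_singleton] at hex hRS
    obtain ⟨w, hw⟩ : (({v} ∪ R)ᶜ).Nonempty := card_pos.1 (by omega)
    simp only [mem_compl, mem_union, mem_singleton, not_or] at hw
    have hcw (x) (hx : x ≠ v) (hxR : x ∉ R) : c x = c w := by
      by_cases hxw : x = w
      · rw [hxw]
      · exact hc x w ((hex x w hxw).2 (by tauto)) (by simpa using hx) (by simpa using hw.1)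
    have hsub : R.erase (c w) ⊆ {a, b} := by
      intro r hr
      obtain ⟨hrw, hr⟩ := mem_erase.1 hr
      obtain ⟨y, hyv, hy⟩ := hnbr r v
      have hry := hy.ne
      have : ¬ H.Adj r y := by
        rw [hex r y hry, not_not]
        refine ⟨.inl hr, hRS r hr, hyv, ?_⟩
        by_cases hyR : y ∈ R
        · rwa [hcR r hr, hcR y hyR]
        · rwa [hcR r hr, hcw y hyv hyR]
      have := ((hGadj r y).1 hy).resolve_left this
      rw [Sym2.eq_iff] at this
      simp only [mem_insert, mem_singleton]
      tauto
    have hab2 : #{a, b} = 2 := card_pair hab.ne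
    have hcwR : c w ∈ R := by
      by_contra h
      have := card_le_card hsub
      rw [erase_eq_of_notMem h] at this
      omega
    have herase : R.erase (c w) = {a, b} :=
      eq_of_subset_of_card_le hsub (by rw [card_erase_of_mem hcwR]; omega)
    have hRab (x) : (x ≠ c w ∧ x ∈ R) ↔ (x = a ∨ x = b) := by
      rw [← mem_erase, herase]; simp
    have hcx (x) (hx : x ≠ v) (hxa : x ≠ a) (hxb : x ≠ b) : c x = c w := by
      by_cases hxR : x ∈ R
      · have := hRab x
        have : x = c w := by tauto
        rw [hcR x hxR, this]
      · exact hcw x hx hxR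
    have ha := (hRab a).2 (.inl rfl)
    have hb := (hRab b).2 (.inr rfl)
    refine ⟨{v}, {a, b}, ?_, hab2, True, .inr ⟨h1, trivial⟩, ?_⟩
    · have hav := hRS a ha.2
      have hbv := hRS b hb.2
      simp [Ne.symm hav, Ne.symm hbv]
    · intro x y
      by_cases hxy : x = y
      · simp [hxy]
      · rw [hGadj, hex x y hxy, Sym2.eq_iff]
        simp only [mem_singleton, mem_insert]
        have hca := hcR a ha.2
        have hcb := hcR b hb.2
        grind
  · rw [h4] at hDcard
    have hex := hexact (by omega)
    have hmem (x) (hx : x ∉ S) : x ∈ R := by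
      have h1 : (S ∪ R)ᶜ = ∅ := card_eq_zero.1 (by omega)
      have h2 : x ∈ S ∪ R := by rw [(compl_eq_empty_iff _).1 h1]; exact mem_univ x
      exact (mem_union.1 h2).resolve_left hx
    have hex' (x y) (hxy : x ≠ y) : H.Adj x y ↔ x ∈ S ∨ y ∈ S := by
      rw [hex x y hxy]
      grind
    have haS := (hex' a b hab.ne).not.1 hHab
    push Not at haS
    refine ⟨S, {a, b}, ?_, card_pair hab.ne, False, .inl ⟨h4, h10, id⟩, ?_⟩
    · simp [haS.1, haS.2]
    · intro x y
      by_cases hxy : x = y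
      · simp [hxy]
      · rw [hGadj, hex' x y hxy, Sym2.eq_iff]
        simp only [mem_singleton, mem_insert]
        clear * - hxy
        grind

/-- A perfect matching of `G` without the edge `e` is a perfect matching of `G` avoiding `e`. -/
lemma exists_isPerfectMatching_notMem_edgeSet {V : Type*} {G : SimpleGraph V} {e : Sym2 V}
    (h : ∃ M : (G.deleteEdges {e}).Subgraph, M.IsPerfectMatching) :
    ∃ P : G.Subgraph, P.IsPerfectMatching ∧ e ∉ P.edgeSet := by
  obtain ⟨M, hM⟩ := h
  refine ⟨⟨M.verts, M.Adj, fun h => (deleteEdges_le {e}) (M.adj_sub h), M.edge_vert, M.symm⟩,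
    hM, ?_⟩
  induction e with
  | _ x y =>
    intro h
    have := M.adj_sub (show M.Adj x y from h)
    simp at this

theorem size_one_excludable_large (n : ℕ) (hn : 10 ≤ n) (hnev : Even n)
    (G : SimpleGraph (Fin n)) (hconn : G.Connected)
    (hdeg : ∀ v, 2 ≤ (G.neighborSet v).ncard)
    (hsize : (n - 2).choose 2 + 3 ≤ G.edgeSet.ncard) :
    oneExcludable G ∨
    Nonempty (G ≃g gJoin (⊤ : SimpleGraph (Fin 4))
      ((⊤ : SimpleGraph (Fin 2)) ⊕g (⊥ : SimpleGraph (Fin 4)))) ∨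
    Nonempty (G ≃g gJoin (⊤ : SimpleGraph (Fin 1))
      ((⊤ : SimpleGraph (Fin 2)) ⊕g (⊤ : SimpleGraph (Fin (n - 3))))) := by
  rw [or_iff_not_imp_left, oneExcludable]
  intro hne
  push Not at hne
  obtain ⟨e, he, hP⟩ := hne
  induction e with
  | _ a b =>
    have hM : ¬ ∃ M : (G.deleteEdges {s(a, b)}).Subgraph, M.IsPerfectMatching := by
      intro h
      obtain ⟨P, h₁, h₂⟩ := exists_isPerfectMatching_notMem_edgeSet h
      exact h₂ (hP P h₁)
    obtain ⟨A, B, hAB, hB, t, ⟨hA, h10, ht⟩ | ⟨hA, ht⟩, hG⟩ :=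
      exists_partition_of_not_isPerfectMatching G (by simpa using hn) (by simpa using hnev) hdeg
        (by simpa using hsize) he hM
    · exact .inl (nonempty_iso_gJoin G A B hAB ⊥ t (by simp [ht]) hA hB (by omega) hG)
    · exact .inr (nonempty_iso_gJoin G A B hAB ⊤ t (by simp [ht]) hA hB
        (by rw [Fintype.card_fin]; omega) hG)
end

section
/- Let G be a connected graph on 6 vertices with minimum degree at least 2. If G has at least 10 edges, then G is 1-excludable, unless G is isomorphic to K_2 ∨ (K_2 ∪ 2K_1). -/
open SimpleGraph

namespace SixVertex

/-- The pairs `(i, j)` with `i < j`. -/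
def pairs : List (Fin 6 × Fin 6) :=
  [(4, 5), (3, 5), (2, 5), (3, 4), (2, 4), (2, 3), (1, 5), (1, 4), (1, 3), (1, 2),
    (0, 5), (0, 4), (0, 3), (0, 2), (0, 1)]

/-- The bit which records the entry `(i, j)` of an adjacency matrix. -/
def pos (i j : Fin 6) : ℕ := 6 * i.val + j.val

/-- The adjacency matrix, as a natural number, of the single edge `ij`. -/
def edgeMask (i j : Fin 6) : ℕ := 2 ^ pos i j ||| 2 ^ pos j i

/-- The perfect matchings of the complete graph on six vertices; the vector `μ` stands for
the matching with edges `{μ 0, μ 1}`, `{μ 2, μ 3}` and `{μ 4, μ 5}`. -/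
def matchings : List (Fin 6 → Fin 6) :=
  [![0, 1, 2, 3, 4, 5], ![0, 1, 2, 4, 3, 5], ![0, 1, 2, 5, 3, 4],
    ![0, 2, 1, 3, 4, 5], ![0, 2, 1, 4, 3, 5], ![0, 2, 1, 5, 3, 4],
    ![0, 3, 1, 2, 4, 5], ![0, 3, 1, 4, 2, 5], ![0, 3, 1, 5, 2, 4],
    ![0, 4, 1, 2, 3, 5], ![0, 4, 1, 3, 2, 5], ![0, 4, 1, 5, 2, 3],
    ![0, 5, 1, 2, 3, 4], ![0, 5, 1, 3, 2, 4], ![0, 5, 1, 4, 2, 3]]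

/-- The permutations of the three blocks `{0, 1}`, `{2, 3}` and `{4, 5}`. -/
def blockPerms : List (Fin 6 → Fin 6) :=
  [![0, 1, 2, 3, 4, 5], ![0, 1, 4, 5, 2, 3], ![2, 3, 0, 1, 4, 5],
    ![2, 3, 4, 5, 0, 1], ![4, 5, 0, 1, 2, 3], ![4, 5, 2, 3, 0, 1]]

/-- The adjacency matrix of a perfect matching. -/
def matchingMask (μ : Fin 6 → Fin 6) : ℕ :=
  edgeMask (μ 0) (μ 1) ||| edgeMask (μ 2) (μ 3) ||| edgeMask (μ 4) (μ 5)

/-- Some row of the adjacency matrix `m` has at most one nonzero entry. -/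
def hasLowDegree (m : ℕ) : Bool :=
  (List.finRange 6).any fun v =>
    let r := (m >>> (6 * v.val)) % 64
    r &&& (r - 1) == 0

/-- Every pair is avoided by a perfect matching contained in `m`. -/
def isExcludable (m : ℕ) : Bool :=
  let q := (matchings.map matchingMask).filter fun p => p &&& m == p
  pairs.all fun e => q.any fun p => !p.testBit (pos e.1 e.2)

/-- Adjacency for `i < j` in `K₂ ∨ (K₂ ∪ 2K₁)`, with blocks `{0, 1}`, `{2, 3}`, `{4, 5}`. -/
def exceptionalAdj (i j : Fin 6) : Bool := decide (i.val < 2) || (i == 2 && j == 3)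

/-- The graph with adjacency matrix `m` is isomorphic to the exceptional graph. -/
def isExceptional (m : ℕ) : Bool :=
  matchings.any fun μ => blockPerms.any fun π =>
    pairs.all fun e => m.testBit (pos (μ (π e.1)) (μ (π e.2))) == exceptionalAdj e.1 e.2

/-- The property verified for every adjacency matrix of a graph with at least ten edges. -/
def verified (m : ℕ) : Bool := hasLowDegree m || isExcludable m || isExceptional m

/-- Check `verified` on all matrices obtained from `m` by adding all but at most `f` of the
listed pairs. -/
def search : List (Fin 6 × Fin 6) → ℕ → ℕ → Bool
  | [], _, m => verified m
  | e :: l, f, m => search l f (m ||| edgeMask e.1 e.2) &&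
      match f with
      | 0 => true
      | f + 1 => search l f m

theorem search_pairs : search pairs 5 0 = true := by decide +kernel

/-- The adjacency matrix of the graph with the listed edges satisfying `a`, added to `m`. -/
def addEdges (a : Fin 6 → Fin 6 → Bool) (l : List (Fin 6 × Fin 6)) (m : ℕ) : ℕ :=
  l.foldl (fun m e => if a e.1 e.2 then m ||| edgeMask e.1 e.2 else m) m

theorem verified_of_search (a : Fin 6 → Fin 6 → Bool) (l : List (Fin 6 × Fin 6)) (f m : ℕ)
    (h : search l f m = true) (hf : l.countP (fun e => !a e.1 e.2) ≤ f) :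
    verified (addEdges a l m) = true := by
  induction l generalizing f m with
  | nil => simpa [search, addEdges] using h
  | cons e l ih =>
    cases ha : a e.1 e.2 with
    | true =>
      have hs : search l f (m ||| edgeMask e.1 e.2) = true := by
        cases f <;> simp_all [search]
      have := ih f _ hs (by simpa [ha] using hf)
      simpa [addEdges, ha] using this
    | false =>
      cases f with
      | zero => simp [ha] at hf
      | succ f =>
        have hs : search l f m = true := by simp_all [search]
        have := ih f _ hs (by simpa [ha] using hf)
        simpa [addEdges, ha] using this

theorem testBit_addEdges (a : Fin 6 → Fin 6 → Bool) (l : List (Fin 6 × Fin 6)) (m k : ℕ) :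
    (addEdges a l m).testBit k = true ↔
      m.testBit k = true ∨ ∃ e ∈ l, a e.1 e.2 = true ∧ (edgeMask e.1 e.2).testBit k = true := by
  induction l generalizing m with
  | nil => simp [addEdges]
  | cons e l ih =>
    have h : addEdges a (e :: l) m =
        addEdges a l (if a e.1 e.2 then m ||| edgeMask e.1 e.2 else m) := rfl
    rw [h, ih]
    cases ha : a e.1 e.2 <;> simp [ha, or_assoc]

theorem testBit_edgeMask : ∀ e ∈ pairs, ∀ i j : Fin 6,
    (edgeMask e.1 e.2).testBit (pos i j) = true ↔ e = (i, j) ∨ e = (j, i) := by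
  decide +kernel

theorem mem_pairs : ∀ i j : Fin 6, i ≠ j → (i, j) ∈ pairs ∨ (j, i) ∈ pairs := by
  decide +kernel

theorem bits_le_one : ∀ r < 64, r &&& (r - 1) = 0 →
    ∀ i j : Fin 6, r.testBit i = true → r.testBit j = true → i = j := by
  decide +kernel

/-- The number `m` is the adjacency matrix of `G`. -/
def IsMask (G : SimpleGraph (Fin 6)) (m : ℕ) : Prop :=
  ∀ i j, m.testBit (pos i j) = true ↔ G.Adj i j

theorem exists_isMask (G : SimpleGraph (Fin 6)) (hsize : 10 ≤ G.edgeSet.ncard) :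
    ∃ m, IsMask G m ∧ verified m = true := by
  classical
  let a : Fin 6 → Fin 6 → Bool := fun i j => decide (G.Adj i j)
  refine ⟨addEdges a pairs 0, fun i j => ?_, verified_of_search a pairs 5 0 search_pairs ?_⟩
  · rw [testBit_addEdges]
    simp only [Nat.zero_testBit, Bool.false_eq_true, false_or]
    constructor
    · rintro ⟨e, he, ha, hb⟩
      rcases (testBit_edgeMask e he i j).1 hb with rfl | rfl
      · simpa [a] using ha
      · simpa [a, G.adj_comm] using ha
    · intro h
      rcases mem_pairs i j h.ne with he | he
      · exact ⟨_, he, by simpa [a] using h, (testBit_edgeMask _ he i j).2 (Or.inl rfl)⟩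
      · exact ⟨_, he, by simpa [a] using h.symm, (testBit_edgeMask _ he i j).2 (Or.inr rfl)⟩
  · have hsub : G.edgeSet ⊆
        ((pairs.filter fun e => a e.1 e.2).map fun e => s(e.1, e.2)).toFinset := by
      intro e
      induction e with
      | _ i j =>
        intro h
        rw [mem_edgeSet] at h
        simp only [List.coe_toFinset, List.mem_map, List.mem_filter, Set.mem_ofPred_eq]
        rcases mem_pairs i j h.ne with he | he
        · exact ⟨_, ⟨he, by simpa [a] using h⟩, rfl⟩
        · exact ⟨_, ⟨he, by simpa [a] using h.symm⟩, Sym2.eq_swap⟩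
    have hcard := Set.ncard_le_ncard hsub (Finset.finite_toSet _)
    rw [Set.ncard_coe_finset] at hcard
    have hlen := hcard.trans (List.toFinset_card_le _)
    rw [List.length_map, ← List.countP_eq_length_filter] at hlen
    have htotal := List.length_eq_countP_add_countP (fun e : Fin 6 × Fin 6 => a e.1 e.2)
      (l := pairs)
    have hpairs : pairs.length = 15 := rfl
    simp only [Bool.not_eq_true, Bool.decide_eq_false] at htotal
    omega

theorem not_hasLowDegree {G : SimpleGraph (Fin 6)} {m : ℕ} (hm : IsMask G m)
    (hdeg : ∀ v, 2 ≤ (G.neighborSet v).ncard) : hasLowDegree m ≠ true := by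
  intro h
  simp only [hasLowDegree, List.any_eq_true, beq_iff_eq] at h
  obtain ⟨v, -, hv⟩ := h
  have hbit (i : Fin 6) (hi : i ∈ G.neighborSet v) :
      (m >>> (6 * v.val) % 64).testBit i = true := by
    rw [show 64 = 2 ^ 6 from rfl, Nat.testBit_mod_two_pow, Nat.testBit_shiftRight]
    simpa [pos] using (hm v i).2 hi
  obtain ⟨i, j, hi, hj, hij⟩ := (Set.one_lt_ncard_iff (Set.toFinite _)).1 (hdeg v)
  exact hij (bits_le_one _ (Nat.mod_lt _ (by norm_num)) hv i j (hbit i hi) (hbit j hj))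

theorem matchingMask_symm : ∀ μ ∈ matchings, ∀ i j,
    (matchingMask μ).testBit (pos i j) = true → (matchingMask μ).testBit (pos j i) = true := by
  rw [← List.forall_iff_forall_mem]
  decide +kernel

theorem matchingMask_existsUnique : ∀ μ ∈ matchings, ∀ i, ∃ j,
    (matchingMask μ).testBit (pos i j) = true ∧
      ∀ k, (matchingMask μ).testBit (pos i k) = true → k = j := by
  rw [← List.forall_iff_forall_mem]
  decide +kernel

theorem oneExcludable_of_isExcludable {G : SimpleGraph (Fin 6)} {m : ℕ} (hm : IsMask G m)
    (h : isExcludable m = true) : oneExcludable G := by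
  simp only [isExcludable, List.all_eq_true, List.any_eq_true, List.mem_filter, List.mem_map,
    beq_iff_eq, Bool.not_eq_true'] at h
  have avoid : ∀ e ∈ pairs, ∃ P : G.Subgraph, P.IsPerfectMatching ∧ s(e.1, e.2) ∉ P.edgeSet := by
    intro e he
    obtain ⟨_, ⟨⟨μ, hμ, rfl⟩, hsub⟩, hbit⟩ := h e he
    refine ⟨{ verts := Set.univ
              Adj := fun i j => (matchingMask μ).testBit (pos i j) = true
              adj_sub := fun {i j} hij => (hm i j).1 ?_
              edge_vert := fun _ => Set.mem_univ _
              symm := ⟨matchingMask_symm μ hμ⟩ }, ?_, ?_⟩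
    · rw [← hsub, Nat.testBit_and, Bool.and_eq_true] at hij
      exact hij.2
    · rw [Subgraph.isPerfectMatching_iff]
      exact matchingMask_existsUnique μ hμ
    · simp [Subgraph.mem_edgeSet, hbit]
  intro e
  induction e with
  | _ i j =>
    intro he
    rcases mem_pairs i j (mem_edgeSet G |>.1 he).ne with hp | hp
    · exact avoid _ hp
    · rw [Sym2.eq_swap]
      exact avoid _ hp

/-- The blocks `{0, 1}`, `{2, 3}` and `{4, 5}` as the parts of `K₂ ∨ (K₂ ∪ 2K₁)`. -/
def block : Fin 2 ⊕ (Fin 2 ⊕ Fin 2) → Fin 6 :=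
  Sum.elim ![0, 1] (Sum.elim ![2, 3] ![4, 5])

theorem bijective_matching_block : ∀ μ ∈ matchings, ∀ π ∈ blockPerms,
    Function.Bijective fun x => μ (π (block x)) := by
  simp only [← List.forall_iff_forall_mem]
  decide +kernel

theorem gJoin_adj_iff (x y : Fin 2 ⊕ (Fin 2 ⊕ Fin 2)) :
    (gJoin (⊤ : SimpleGraph (Fin 2)) ((⊤ : SimpleGraph (Fin 2)) ⊕g (⊥ : SimpleGraph (Fin 2)))).Adj
      x y ↔ ((block x, block y) ∈ pairs ∧ exceptionalAdj (block x) (block y) = true) ∨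
        ((block y, block x) ∈ pairs ∧ exceptionalAdj (block y) (block x) = true) := by
  rcases x with x | x | x <;> rcases y with y | y | y <;> fin_cases x <;> fin_cases y <;>
    simp [gJoin, block, pairs, exceptionalAdj]

theorem nonempty_iso_of_isExceptional {G : SimpleGraph (Fin 6)} {m : ℕ} (hm : IsMask G m)
    (h : isExceptional m = true) :
    Nonempty (G ≃g gJoin (⊤ : SimpleGraph (Fin 2))
      ((⊤ : SimpleGraph (Fin 2)) ⊕g (⊥ : SimpleGraph (Fin 2)))) := by
  simp only [isExceptional, List.any_eq_true, List.all_eq_true, beq_iff_eq] at h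
  obtain ⟨μ, hμ, π, hπ, h⟩ := h
  have hbij := bijective_matching_block μ hμ π hπ
  have hadj : ∀ e ∈ pairs, G.Adj (μ (π e.1)) (μ (π e.2)) ↔ exceptionalAdj e.1 e.2 = true :=
    fun e he => by rw [← hm, h e he]
  refine ⟨RelIso.symm ⟨Equiv.ofBijective _ hbij, fun {x y} => ?_⟩⟩
  rw [gJoin_adj_iff]
  constructor
  · intro hxy
    have hne : block x ≠ block y := fun h => hxy.ne (by simp [h])
    rcases mem_pairs _ _ hne with hp | hp
    · exact Or.inl ⟨hp, (hadj _ hp).1 hxy⟩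
    · exact Or.inr ⟨hp, (hadj _ hp).1 hxy.symm⟩
  · rintro (⟨hp, he⟩ | ⟨hp, he⟩)
    · exact (hadj _ hp).2 he
    · exact ((hadj _ hp).2 he).symm

end SixVertex

theorem size_one_excludable_six (G : SimpleGraph (Fin 6)) (hconn : G.Connected)
    (hdeg : ∀ v, 2 ≤ (G.neighborSet v).ncard)
    (hsize : 10 ≤ G.edgeSet.ncard) :
    oneExcludable G ∨
    Nonempty (G ≃g gJoin (⊤ : SimpleGraph (Fin 2))
      ((⊤ : SimpleGraph (Fin 2)) ⊕g (⊥ : SimpleGraph (Fin 2)))) := by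
  obtain ⟨m, hm, hv⟩ := SixVertex.exists_isMask G hsize
  simp only [SixVertex.verified, Bool.or_eq_true] at hv
  rcases hv with (hlow | hexcl) | hexc
  · exact absurd hlow (SixVertex.not_hasLowDegree hm hdeg)
  · exact Or.inl (SixVertex.oneExcludable_of_isExcludable hm hexcl)
  · exact Or.inr (SixVertex.nonempty_iso_of_isExceptional hm hexc)
end

section
/- Let G be a connected graph on 8 vertices with minimum degree at least 2. If G has at least 19 edges, then G is 1-excludable, unless G is isomorphic to K_3 ∨ (K_2 ∪ 3K_1). -/
open SimpleGraph

universe u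

/-- The Tutte–Berge obstruction in coloring form: if a graph of even order has no perfect matching,
then some vertex set `S` admits a transversal `R` of `#S + 2` connected components of its
complement. -/
theorem exists_transversal_of_no_perfectMatching {V : Type u} [Fintype V]
    (H : SimpleGraph V) (heven : Even (Fintype.card V))
    (hH : ∀ M : H.Subgraph, ¬ M.IsPerfectMatching) :
    ∃ (S R : Finset V) (ι : Type u) (f : V → ι), Disjoint R S ∧ R.card = S.card + 2 ∧
      Set.InjOn f R ∧ ∀ a b, a ∉ S → b ∉ S → H.Adj a b → f a = f b := by
  classical
  have hT : ¬ ∀ u, ¬ H.IsTutteViolator u := fun h ↦ by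
    obtain ⟨M, hM⟩ := SimpleGraph.tutte.2 h
    exact hH M hM
  push Not at hT
  obtain ⟨u, hu⟩ := hT
  let K := ((⊤ : H.Subgraph).deleteVerts u).coe
  change u.ncard < K.oddComponents.ncard at hu
  have hverts : ((⊤ : H.Subgraph).deleteVerts u).verts = uᶜ := by
    ext x; simp
  have hcard : Nat.card ((⊤ : H.Subgraph).deleteVerts u).verts + u.ncard = Fintype.card V := by
    rw [Nat.card_coe_set_eq, hverts, ← Nat.card_eq_fintype_card, ← Set.ncard_add_ncard_compl u]
    omega
  have hodd : Odd K.oddComponents.ncard ↔ Odd u.ncard := by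
    rw [SimpleGraph.odd_ncard_oddComponents]
    grind
  have hle : u.ncard + 2 ≤ K.oddComponents.ncard := by
    grind
  obtain ⟨T, -, hTcard⟩ := Set.exists_subset_card_eq hle
  let f : V → Option K.ConnectedComponent := fun v ↦
    if h : v ∈ ((⊤ : H.Subgraph).deleteVerts u).verts then some (K.connectedComponentMk ⟨v, h⟩)
    else none
  let g : K.ConnectedComponent → V := fun c ↦ c.out.1
  have hgu (c) : g c ∉ u := by
    have h : g c ∈ ((⊤ : H.Subgraph).deleteVerts u).verts := c.out.2
    rwa [hverts] at h
  have hfg (c) : f (g c) = some c := by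
    have h : g c ∈ ((⊤ : H.Subgraph).deleteVerts u).verts := c.out.2
    simp only [f, dif_pos h]
    exact congrArg some (Quot.out_eq c)
  have hginj : Function.Injective g := fun c d h ↦ by
    have := hfg c
    rw [h, hfg] at this
    exact (Option.some.inj this).symm
  refine ⟨u.toFinset, (g '' T).toFinset, _, f, ?_, ?_, ?_, ?_⟩
  · rw [Finset.disjoint_left]
    intro a ha
    simp only [Set.mem_toFinset, Set.mem_image] at ha ⊢
    obtain ⟨c, -, rfl⟩ := ha
    exact hgu c
  · rw [← Set.ncard_eq_toFinset_card', ← Set.ncard_eq_toFinset_card',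
      Set.ncard_image_of_injective _ hginj, hTcard]
  · intro a ha b hb hab
    simp only [Set.coe_toFinset, Set.mem_image] at ha hb
    obtain ⟨c, -, rfl⟩ := ha
    obtain ⟨d, -, rfl⟩ := hb
    rw [hfg, hfg] at hab
    rw [Option.some.inj hab]
  · intro a b ha hb hab
    have ha' : a ∈ ((⊤ : H.Subgraph).deleteVerts u).verts := by simpa using ha
    have hb' : b ∈ ((⊤ : H.Subgraph).deleteVerts u).verts := by simpa using hb
    simp only [f, dif_pos ha', dif_pos hb', Option.some.injEq]
    apply SimpleGraph.ConnectedComponent.sound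
    apply SimpleGraph.Adj.reachable
    simp only [K, SimpleGraph.Subgraph.coe_adj, SimpleGraph.Subgraph.deleteVerts_adj]
    simp only [SimpleGraph.Subgraph.verts_top, Set.mem_univ, SimpleGraph.Subgraph.top_adj]
    simp_all

/-- If `f` is constant along the edges of `H` inside `W` and injective on `R ⊆ W`, then `Hᶜ` has
many edges inside `W`. -/
theorem card_compl_adj_of_transversal {V ι : Type*} [Fintype V] [DecidableEq V] [DecidableEq ι]
    (H : SimpleGraph V) [DecidableRel H.Adj] (W R : Finset V) (f : V → ι) (hRW : R ⊆ W)
    (hf : Set.InjOn f R) (hH : ∀ a ∈ W, ∀ b ∈ W, H.Adj a b → f a = f b) :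
    2 * (W.card * (R.card - 1)) ≤
      (Finset.univ.filter fun p : V × V ↦ Hᶜ.Adj p.1 p.2).card + (R.card * R.card - R.card) := by
  let P := (W ×ˢ R).filter fun p ↦ f p.2 ≠ f p.1
  have hP : W.card * (R.card - 1) ≤ P.card := by
    simp only [P, Finset.card_filter, Finset.sum_product]
    rw [← smul_eq_mul]
    refine Finset.card_nsmul_le_sum _ _ _ fun w hw ↦ ?_
    rw [← Finset.card_filter]
    have h1 : (R.filter fun r ↦ f r = f w).card ≤ 1 := by
      rw [Finset.card_le_one]
      intro a ha b hb
      simp only [Finset.mem_filter] at ha hb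
      exact hf ha.1 hb.1 (ha.2.trans hb.2.symm)
    have := Finset.card_filter_add_card_filter_not (s := R) (fun r ↦ f r = f w)
    simp only [ne_eq]
    omega
  let Q := P.image Prod.swap
  have hQ : Q.card = P.card := Finset.card_image_of_injective _ Prod.swap_injective
  have hunion : P ∪ Q ⊆ Finset.univ.filter fun p : V × V ↦ Hᶜ.Adj p.1 p.2 := by
    rintro ⟨a, b⟩ hab
    simp only [P, Q, Finset.mem_union, Finset.mem_image, Finset.mem_filter, Finset.mem_product,
      Prod.exists, Prod.swap_prod_mk, Prod.mk.injEq, Finset.mem_univ, true_and,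
      SimpleGraph.compl_adj] at hab ⊢
    grind
  have hinter : P ∩ Q ⊆ R.offDiag := by
    rintro ⟨a, b⟩ hab
    simp only [P, Q, Finset.mem_inter, Finset.mem_image, Finset.mem_filter, Finset.mem_product,
      Prod.exists, Prod.swap_prod_mk, Prod.mk.injEq, Finset.mem_offDiag] at hab ⊢
    grind
  have h1 := Finset.card_le_card hunion
  have h2 := Finset.card_le_card hinter
  have h3 := Finset.card_union_add_card_inter P Q
  rw [Finset.offDiag_card] at h2
  omega

/-- Ordered adjacent pairs of a graph and of its complement, together with the diagonal, exhaust
all pairs. -/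
theorem card_compl_adj_add {V : Type*} [Fintype V] [DecidableEq V]
    (H : SimpleGraph V) [DecidableRel H.Adj] :
    (Finset.univ.filter fun p : V × V ↦ Hᶜ.Adj p.1 p.2).card + 2 * H.edgeSet.ncard +
      Fintype.card V = Fintype.card V * Fintype.card V := by
  have h : (Finset.univ.filter fun p : V × V ↦ Hᶜ.Adj p.1 p.2).card = 2 * Hᶜ.edgeFinset.card :=
    (SimpleGraph.two_mul_card_edgeFinset Hᶜ).symm
  rw [h, ← SimpleGraph.sum_degrees_eq_twice_card_edges, ← SimpleGraph.coe_edgeFinset,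
    Set.ncard_coe_finset, ← SimpleGraph.sum_degrees_eq_twice_card_edges,
    ← Finset.sum_add_distrib]
  rw [Finset.sum_congr rfl (g := fun _ ↦ Fintype.card V - 1)]
  · simp only [Finset.sum_const, Finset.card_univ, smul_eq_mul]
    cases Fintype.card V <;> simp [Nat.mul_succ]
  · intro v _
    have := H.degree_lt_card_verts v
    rw [SimpleGraph.degree_compl]
    omega

/-- A graph consisting of all edges meeting a `3`-set, and one further edge, on `8` vertices. -/
theorem nonempty_iso_gJoin_of_adj_iff (G : SimpleGraph (Fin 8)) (S : Finset (Fin 8))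
    (hS : S.card = 3) (x y : Fin 8) (hx : x ∉ S) (hy : y ∉ S) (hxy : x ≠ y)
    (hG : ∀ a b, G.Adj a b ↔ a ≠ b ∧ (a ∈ S ∨ b ∈ S) ∨ s(a, b) = s(x, y)) :
    Nonempty (G ≃g gJoin (⊤ : SimpleGraph (Fin 3))
      ((⊤ : SimpleGraph (Fin 2)) ⊕g (⊥ : SimpleGraph (Fin 3)))) := by
  have hT : (Sᶜ \ {x, y}).card = 3 := by
    rw [Finset.card_sdiff_of_subset (by simp [Finset.insert_subset_iff, hx, hy]), Finset.card_compl, hS, Finset.card_pair hxy,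
      Fintype.card_fin]
  let e₁ := (Fintype.equivFinOfCardEq (by simpa using hS) : S ≃ Fin 3)
  let e₂ := (Fintype.equivFinOfCardEq ((Fintype.card_coe _).trans hT) : (Sᶜ \ {x, y} : Finset _) ≃ Fin 3)
  let g : Fin 3 ⊕ (Fin 2 ⊕ Fin 3) → Fin 8 :=
    Sum.elim (fun i ↦ (e₁.symm i).1) (Sum.elim ![x, y] fun i ↦ (e₂.symm i).1)
  have hg₁ (i) : g (.inl i) ∈ S := (e₁.symm i).2
  have hg₂ (i) : g (.inr (.inl i)) = x ∨ g (.inr (.inl i)) = y := by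
    fin_cases i <;> simp [g]
  have hg₃ (i) : g (.inr (.inr i)) ∉ S ∧ g (.inr (.inr i)) ≠ x ∧ g (.inr (.inr i)) ≠ y := by
    have h : g (.inr (.inr i)) ∈ Sᶜ \ {x, y} := (e₂.symm i).2
    simpa using h
  have hi₁ (i j) : g (.inl i) = g (.inl j) ↔ i = j := by simp [g]
  have hi₂ (i j) : g (.inr (.inl i)) = g (.inr (.inl j)) ↔ i = j := by
    fin_cases i <;> fin_cases j <;> simp [g, hxy, hxy.symm]
  have hi₃ (i j) : g (.inr (.inr i)) = g (.inr (.inr j)) ↔ i = j := by simp [g]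
  have hginj : Function.Injective g := by
    rintro (i | i | i) (j | j | j) h <;> grind
  have hgbij : Function.Bijective g :=
    (Fintype.bijective_iff_injective_and_card g).2 ⟨hginj, by simp⟩
  refine ⟨(RelIso.symm ⟨Equiv.ofBijective g hgbij, ?_⟩)⟩
  rintro (i | i | i) (j | j | j) <;>
    simp [gJoin, hG, SimpleGraph.fromRel_adj] <;> grind

theorem size_one_excludable_eight (G : SimpleGraph (Fin 8)) (hconn : G.Connected)
    (hdeg : ∀ v, 2 ≤ (G.neighborSet v).ncard)
    (hsize : 19 ≤ G.edgeSet.ncard) :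
    oneExcludable G ∨
    Nonempty (G ≃g gJoin (⊤ : SimpleGraph (Fin 3))
      ((⊤ : SimpleGraph (Fin 2)) ⊕g (⊥ : SimpleGraph (Fin 3)))) := by
  classical
  rw [or_iff_not_imp_left]
  intro hne
  unfold oneExcludable at hne
  push Not at hne
  obtain ⟨e, he, hM⟩ := hne
  let H := G.deleteEdges {e}
  have hHG : H ≤ G := G.deleteEdges_le _
  have hHadj (a b) : H.Adj a b ↔ G.Adj a b ∧ s(a, b) ≠ e := by simp [H]
  have hHM (M : H.Subgraph) : ¬ M.IsPerfectMatching := fun h ↦ by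
    have hle : M.spanningCoe ≤ G := M.spanningCoe_le.trans hHG
    have hmem := hM _ ((SimpleGraph.Subgraph.IsPerfectMatching.toSubgraph_iff hle).2 h)
    induction e with | h x y => exact ((hHadj x y).1 (M.adj_sub hmem)).2 rfl
  have hHcard : H.edgeSet.ncard + 1 = G.edgeSet.ncard := by
    rw [SimpleGraph.edgeSet_deleteEdges]
    exact Set.ncard_sdiff_singleton_add_one he
  have hN := card_compl_adj_add H
  set N := Finset.univ.filter fun p : Fin 8 × Fin 8 ↦ Hᶜ.Adj p.1 p.2 with hNdef
  rw [Fintype.card_fin] at hN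
  obtain ⟨S, R, ι, f, hdisj, hRS, hinj, hf⟩ :=
    exists_transversal_of_no_perfectMatching H (by simp; decide) hHM
  have hsub : R ⊆ Sᶜ := Finset.subset_compl_iff_disjoint_right.2 hdisj
  have hSc : Sᶜ.card = 8 - S.card := by simp [Finset.card_compl]
  have hle := Finset.card_le_card hsub
  have hcount := card_compl_adj_of_transversal H Sᶜ R f hsub hinj fun a ha b hb ↦
    hf a b (Finset.mem_compl.1 ha) (Finset.mem_compl.1 hb)
  rw [← hNdef, hSc, hRS] at hcount
  have hS3 : S.card ≤ 3 := by omega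
  obtain hS | hS | hS | hS : S.card = 0 ∨ S.card = 1 ∨ S.card = 2 ∨ S.card = 3 := by omega
  · have hS0 : S = ∅ := Finset.card_eq_zero.1 hS
    subst hS0
    have hnbr (v) : ∃ w, H.Adj v w := by
      obtain ⟨a, ha, b, hb, hab⟩ := (Set.one_lt_ncard_iff_nontrivial).1 (hdeg v)
      by_cases hva : s(v, a) = e
      · refine ⟨b, (hHadj v b).2 ⟨hb, fun h ↦ hab ?_⟩⟩
        exact Sym2.congr_right.1 (hva.trans h.symm)
      · exact ⟨a, (hHadj v a).2 ⟨ha, hva⟩⟩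
    obtain ⟨r, t, hrt, rfl⟩ := Finset.card_eq_two.1 (by simpa using hRS)
    have hfrt : f r ≠ f t := fun h ↦ hrt (hinj (by simp) (by simp) h)
    obtain ⟨r', hr'⟩ := hnbr r
    obtain ⟨t', ht'⟩ := hnbr t
    have hfr := hf _ _ (by simp) (by simp) hr'
    have hft := hf _ _ (by simp) (by simp) ht'
    let A := Finset.univ.filter fun a ↦ f a = f r
    have hA : 2 ≤ A.card := by
      rw [← Finset.card_pair hr'.ne]
      apply Finset.card_le_card
      simp [A, Finset.insert_subset_iff, hfr]
    have hAc : 2 ≤ Aᶜ.card := by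
      rw [← Finset.card_pair ht'.ne]
      apply Finset.card_le_card
      simp [A, Finset.insert_subset_iff, ← hft, hfrt.symm]
    have hsubN : A ×ˢ Aᶜ ∪ Aᶜ ×ˢ A ⊆ N := by
      rintro ⟨a, b⟩ hab
      have hfab := hf a b (by simp) (by simp)
      simp only [Finset.mem_union, Finset.mem_product, Finset.mem_compl, A, Finset.mem_filter,
        Finset.mem_univ, true_and, N, SimpleGraph.compl_adj] at hab ⊢
      grind
    have hcardN := Finset.card_le_card hsubN
    rw [Finset.card_union_of_disjoint, Finset.card_product, Finset.card_product,
      Finset.card_compl, Fintype.card_fin] at hcardN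
    · rw [Finset.card_compl, Fintype.card_fin] at hAc
      have hA6 : A.card ≤ 6 := by omega
      generalize A.card = n at *
      interval_cases n <;> omega
    · rw [Finset.disjoint_left]
      rintro ⟨a, b⟩
      simp only [Finset.mem_product, Finset.mem_compl]
      tauto
  · rw [hS] at hcount
    omega
  · rw [hS] at hcount
    omega
  · have hR : R = Sᶜ := Finset.eq_of_subset_of_card_le hsub (by omega)
    subst hR
    have hsubN : Sᶜ.offDiag ⊆ N := by
      rintro ⟨a, b⟩ hab
      simp only [Finset.mem_offDiag, N, Finset.mem_filter, Finset.mem_univ, true_and,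
        SimpleGraph.compl_adj] at hab ⊢
      refine ⟨hab.2.2, fun h ↦ hab.2.2 (hinj hab.1 hab.2.1 ?_)⟩
      exact hf a b (Finset.mem_compl.1 hab.1) (Finset.mem_compl.1 hab.2.1) h
    have hNeq : Sᶜ.offDiag = N := Finset.eq_of_subset_of_card_le hsubN (by
      rw [Finset.offDiag_card, hSc, hS]
      omega)
    have hHiff (a b) : H.Adj a b ↔ a ≠ b ∧ (a ∈ S ∨ b ∈ S) := by
      have h : (a, b) ∈ Sᶜ.offDiag ↔ (a, b) ∈ N := by rw [hNeq]
      simp only [Finset.mem_offDiag, N, Finset.mem_filter, Finset.mem_univ, true_and,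
        SimpleGraph.compl_adj, Finset.mem_compl] at h
      have := H.ne_of_adj (a := a) (b := b)
      tauto
    induction e with | h x y =>
    have hxy : x ≠ y := G.ne_of_adj he
    have hnot : ¬ H.Adj x y := by simp [hHadj]
    rw [hHiff] at hnot
    refine nonempty_iso_gJoin_of_adj_iff G S hS x y (by tauto) (by tauto) hxy fun a b ↦ ?_
    rw [← hHiff, hHadj]
    have hab : s(a, b) = s(x, y) → G.Adj a b := fun h ↦ by
      rw [← SimpleGraph.mem_edgeSet, h]
      exact he
    tauto
end

section
/- Let k be a positive integer and n an even positive integer. If G is a connected graph on n vertices whose adjacency spectral radius satisfies ρ(G) ≥ ρ(K_{2k} ∨ (K_{n-2k-1} ∪ K_1)), then G is k-extendable, unless G is isomorphic to K_{2k} ∨ (K_{n-2k-1} ∪ K_1). -/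
open SimpleGraph

open scoped Classical in
/-- The adjacency spectral radius of a finite simple graph: the largest real
eigenvalue of its adjacency matrix. -/
noncomputable def specRad {V : Type*} [Fintype V] (G : SimpleGraph V) : ℝ :=
  sSup {μ : ℝ | ∃ v : V → ℝ, v ≠ 0 ∧
    Matrix.mulVec (Matrix.of fun i j => if G.Adj i j then (1:ℝ) else 0) v = μ • v}

/-- `G` is `k`-extendable: every matching of size `k` in `G` extends to a
perfect matching of `G`. -/
def kExtendable {V : Type*} (G : SimpleGraph V) (k : ℕ) : Prop :=
  ∀ M : G.Subgraph, M.IsMatching → M.edgeSet.ncard = k →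
    ∃ P : G.Subgraph, P.IsPerfectMatching ∧ M.edgeSet ⊆ P.edgeSet


open scoped Classical in
/-- The adjacency operator of `G` applied to `z`, evaluated at `i`. -/
noncomputable def adjSum {V : Type*} [Fintype V] (G : SimpleGraph V) (z : V → ℝ) (i : V) : ℝ :=
  ∑ j, if G.Adj i j then z j else 0

open scoped Classical in
lemma mulVec_eq_adjSum {V : Type*} [Fintype V] (G : SimpleGraph V) (z : V → ℝ) :
    Matrix.mulVec (Matrix.of fun i j => if G.Adj i j then (1:ℝ) else 0) z = adjSum G z := by
  ext i
  simp [Matrix.mulVec, dotProduct, adjSum]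

lemma sum_mul_adjSum_comm {V : Type*} [Fintype V] (G : SimpleGraph V) (z w : V → ℝ) :
    ∑ i, z i * adjSum G w i = ∑ i, w i * adjSum G z i := by
  classical
  simp only [adjSum, Finset.mul_sum]
  rw [Finset.sum_comm]
  refine Finset.sum_congr rfl fun i _ => Finset.sum_congr rfl fun j _ => ?_
  simp only [G.adj_comm j i]
  split_ifs <;> ring

/-- If a positive vector `z` satisfies `A z ≤ θ z` on a connected graph having an eigenvalue at
least `θ`, then `A z = θ z`. -/
lemma adjSum_eq_of_eigenvalue_ge {V : Type*} [Fintype V] {G : SimpleGraph V}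
    (hG : G.Connected) {z : V → ℝ} (hz : ∀ i, 0 < z i) {θ μ : ℝ}
    (hle : ∀ i, adjSum G z i ≤ θ * z i) {v : V → ℝ} (hv : v ≠ 0)
    (heig : adjSum G v = μ • v) (hμ : θ ≤ μ) (i : V) : adjSum G z i = θ * z i := by
  classical
  have hw : ∀ i, θ * |v i| ≤ adjSum G (fun j => |v j|) i := fun i => by
    have h1 : adjSum G v i = μ * v i := by rw [heig]; rfl
    calc θ * |v i| ≤ |μ| * |v i| := by gcongr; exact hμ.trans (le_abs_self μ)
      _ = |adjSum G v i| := by rw [h1, abs_mul]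
      _ ≤ ∑ j, |if G.Adj i j then v j else 0| := Finset.abs_sum_le_sum_abs _ _
      _ = adjSum G (fun j => |v j|) i := by
        unfold adjSum
        refine Finset.sum_congr rfl fun j _ => ?_
        split_ifs <;> simp
  have hcomm := sum_mul_adjSum_comm G z (fun j => |v j|)
  have hA : ∀ i, 0 ≤ z i * (adjSum G (fun j => |v j|) i - θ * |v i|) := fun i =>
    mul_nonneg (hz i).le (sub_nonneg.2 (hw i))
  have hB : ∀ i, 0 ≤ |v i| * (θ * z i - adjSum G z i) := fun i =>
    mul_nonneg (abs_nonneg _) (sub_nonneg.2 (hle i))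
  have hsum : ∑ i, (z i * (adjSum G (fun j => |v j|) i - θ * |v i|)
      + |v i| * (θ * z i - adjSum G z i)) = 0 := by
    have : ∀ i, (z i * (adjSum G (fun j => |v j|) i - θ * |v i|)
      + |v i| * (θ * z i - adjSum G z i))
      = z i * adjSum G (fun j => |v j|) i - |v i| * adjSum G z i := fun i => by ring
    simp only [this, Finset.sum_sub_distrib, hcomm, sub_self]
  rw [Finset.sum_eq_zero_iff_of_nonneg fun i _ => add_nonneg (hA i) (hB i)] at hsum
  have hAz : ∀ i, adjSum G (fun j => |v j|) i = θ * |v i| := fun i => by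
    have h := hsum i (Finset.mem_univ i)
    have h0 : z i * (adjSum G (fun j => |v j|) i - θ * |v i|) = 0 := by
      linarith [hA i, hB i]
    have := (mul_eq_zero.1 h0).resolve_left (hz i).ne'
    linarith
  have hstep : ∀ i j, G.Adj i j → v i = 0 → v j = 0 := fun i j hij hi => by
    have h := hAz i
    rw [hi, abs_zero, mul_zero, adjSum, Finset.sum_eq_zero_iff_of_nonneg] at h
    · simpa [hij] using h j (Finset.mem_univ j)
    · intro k _
      split_ifs <;> simp
  have hne : v i ≠ 0 := fun hi => hv <| by
    ext j
    obtain ⟨p⟩ := hG.preconnected i j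
    induction p with
    | nil => exact hi
    | cons h _ ih => exact ih (hstep _ _ h hi)
  have h := hsum i (Finset.mem_univ i)
  have h0 : |v i| * (θ * z i - adjSum G z i) = 0 := by linarith [hA i, hB i]
  have := (mul_eq_zero.1 h0).resolve_left (abs_ne_zero.2 hne)
  linarith

lemma finite_setOf_eigenvalue {V : Type*} [Fintype V] (G : SimpleGraph V) :
    {μ : ℝ | ∃ v : V → ℝ, v ≠ 0 ∧ adjSum G v = μ • v}.Finite := by
  classical
  let A : Matrix V V ℝ := Matrix.of fun i j => if G.Adj i j then (1:ℝ) else 0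
  refine (Module.End.finite_hasEigenvalue (Matrix.toLin' A)).subset ?_
  rintro μ ⟨v, hv, h⟩
  refine Module.End.hasEigenvalue_of_hasEigenvector (x := v) ⟨?_, hv⟩
  rw [Module.End.mem_eigenspace_iff, Matrix.toLin'_apply, ← h, ← mulVec_eq_adjSum]

lemma le_specRad {V : Type*} [Fintype V] {G : SimpleGraph V} {v : V → ℝ} {θ : ℝ} (hv : v ≠ 0)
    (h : adjSum G v = θ • v) : θ ≤ specRad G := by
  simp only [specRad, mulVec_eq_adjSum]
  exact le_csSup (finite_setOf_eigenvalue G).bddAbove ⟨v, hv, h⟩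

lemma exists_eigenvalue_ge {V : Type*} [Fintype V] {G : SimpleGraph V} {θ : ℝ} (hθ : 0 < θ)
    (h : θ ≤ specRad G) : ∃ μ, θ ≤ μ ∧ ∃ v : V → ℝ, v ≠ 0 ∧ adjSum G v = μ • v := by
  simp only [specRad, mulVec_eq_adjSum] at h
  have hne : {μ : ℝ | ∃ v : V → ℝ, v ≠ 0 ∧ adjSum G v = μ • v}.Nonempty := by
    rw [Set.nonempty_iff_ne_empty]
    intro h0
    rw [h0, Real.sSup_empty] at h
    linarith
  exact ⟨_, h, hne.csSup_mem (finite_setOf_eigenvalue G)⟩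

lemma ncard_verts_of_isMatching {V : Type*} [Fintype V] {G : SimpleGraph V} {M : G.Subgraph}
    (hM : M.IsMatching) : M.verts.ncard = 2 * M.edgeSet.ncard := by
  classical
  have h := M.spanningCoe.sum_degrees_eq_twice_card_edges
  have hdeg : ∀ v, M.spanningCoe.degree v = if v ∈ M.verts then 1 else 0 := fun v => by
    rw [Subgraph.degree_spanningCoe]
    split_ifs with hv
    · exact Subgraph.isMatching_iff_forall_degree.1 hM v hv
    · exact Subgraph.degree_of_notMem_verts hv
  simp only [hdeg, Finset.sum_boole, Nat.cast_id] at h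
  rw [Set.ncard_eq_toFinset_card', Set.ncard_eq_toFinset_card', ← Set.filter_mem_univ_eq_toFinset,
    h]
  congr 2
  ext e
  simp

lemma exists_isPerfectMatching_of_induce_compl {V : Type*} {G : SimpleGraph V} {M : G.Subgraph}
    (hM : M.IsMatching) {P : (G.induce M.vertsᶜ).Subgraph} (hP : P.IsPerfectMatching) :
    ∃ Q : G.Subgraph, Q.IsPerfectMatching ∧ M.edgeSet ⊆ Q.edgeSet := by
  let f := (Embedding.induce (G := G) M.vertsᶜ)
  have hPf : (P.map f.toHom).IsMatching := hP.1.map _ f.injective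
  have hv : (P.map f.toHom).verts = M.vertsᶜ := by
    ext v
    simp only [Subgraph.map_verts, Set.mem_image]
    constructor
    · rintro ⟨x, -, rfl⟩
      exact x.2
    · exact fun h => ⟨⟨v, h⟩, hP.2 _, rfl⟩
  refine ⟨M ⊔ P.map f.toHom, ⟨hM.sup hPf ?_, fun v => ?_⟩, ?_⟩
  · rw [hM.support_eq_verts, hPf.support_eq_verts, hv]
    exact disjoint_compl_right
  · rw [Subgraph.verts_sup, hv, Set.union_compl_self]
    trivial
  · rw [Subgraph.edgeSet_sup]
    exact Set.subset_union_left

/-- In a graph of even order with no perfect matching, some vertex set `S` can be deleted so that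
the remaining graph has at least `|S| + 2` components. -/
lemma exists_card_add_two_le_components {V : Type*} [Finite V] {G : SimpleGraph V}
    (heven : Even (Nat.card V)) (h : ∀ P : G.Subgraph, ¬ P.IsPerfectMatching) :
    ∃ S : Set V, S.ncard + 2 ≤
      Nat.card ((⊤ : G.Subgraph).deleteVerts S).coe.ConnectedComponent := by
  have hT : ∃ S, G.IsTutteViolator S := by
    by_contra! hno
    obtain ⟨P, hP⟩ := tutte.2 hno
    exact h P hP
  obtain ⟨S, hS⟩ := hT
  refine ⟨S, ?_⟩
  have hpar := odd_ncard_oddComponents ((⊤ : G.Subgraph).deleteVerts S).coe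
  have hcard : Nat.card ((⊤ : G.Subgraph).deleteVerts S).verts + S.ncard = Nat.card V := by
    rw [Subgraph.deleteVerts_verts, Subgraph.verts_top, ← Set.compl_eq_univ_sdiff, add_comm]
    exact Set.ncard_add_ncard_compl S
  have hle := Set.ncard_le_card ((⊤ : G.Subgraph).deleteVerts S).coe.oddComponents
  unfold IsTutteViolator at hS
  grind

/-- A matching of size `k` which does not extend to a perfect matching yields a set `T` of
`2k + s` vertices whose removal splits the graph into `s + 2` nonempty parts. -/
lemma exists_coloring_of_not_extends {V : Type*} [Fintype V] {G : SimpleGraph V}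
    (heven : Even (Fintype.card V)) {M : G.Subgraph} (hM : M.IsMatching)
    (hno : ¬ ∃ P : G.Subgraph, P.IsPerfectMatching ∧ M.edgeSet ⊆ P.edgeSet) :
    ∃ (s : ℕ) (T : Finset V) (col : V → Fin (s + 2)), T.card = 2 * M.edgeSet.ncard + s ∧
      (∀ u v, u ∉ T → v ∉ T → G.Adj u v → col u = col v) ∧ ∀ i, ∃ v, v ∉ T ∧ col v = i := by
  classical
  have hcard := ncard_verts_of_isMatching hM
  have hcompl : M.verts.ncard + M.vertsᶜ.ncard = Nat.card V := Set.ncard_add_ncard_compl _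
  rw [Nat.card_eq_fintype_card] at hcompl
  have heven' : Even (Nat.card (M.vertsᶜ : Set V)) := by
    change Even (M.vertsᶜ.ncard)
    grind
  obtain ⟨S, hS⟩ := exists_card_add_two_le_components (G := G.induce M.vertsᶜ) heven'
    fun P hP => hno (exists_isPerfectMatching_of_induce_compl hM hP)
  set H := ((⊤ : (G.induce M.vertsᶜ).Subgraph).deleteVerts S) with hH
  obtain ⟨g, hg⟩ : ∃ g : H.coe.ConnectedComponent → Fin (S.ncard + 2), Function.Surjective g := by
    obtain ⟨e⟩ : Nonempty (Fin (S.ncard + 2) ↪ H.coe.ConnectedComponent) :=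
      Function.Embedding.nonempty_of_card_le (by
        rwa [Fintype.card_fin, ← Nat.card_eq_fintype_card])
    exact ⟨Function.invFun e, Function.invFun_surjective e.injective⟩
  have hmem : ∀ v (h : v ∉ M.verts), (⟨v, h⟩ : (M.vertsᶜ : Set V)) ∉ S →
      (⟨v, h⟩ : (M.vertsᶜ : Set V)) ∈ H.verts := fun v h hv => ⟨trivial, hv⟩
  let T : Set V := M.verts ∪ Subtype.val '' S
  have hT : ∀ v, v ∉ T ↔ ∃ h : v ∉ M.verts, (⟨v, h⟩ : (M.vertsᶜ : Set V)) ∉ S := fun v => by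
    simp only [T, Set.mem_union, Set.mem_image, not_or]
    grind
  refine ⟨S.ncard, T.toFinset, fun v => if h : v ∉ T then
    g (H.coe.connectedComponentMk ⟨⟨v, ((hT v).1 h).1⟩, hmem v _ ((hT v).1 h).2⟩) else 0, ?_, ?_, ?_⟩
  · rw [← Set.ncard_eq_toFinset_card', Set.ncard_union_eq, hcard,
      Set.ncard_image_of_injective _ Subtype.val_injective]
    rw [Set.disjoint_left]
    rintro v hv ⟨x, -, rfl⟩
    exact x.2 hv
  · intro u v hu hv huv
    rw [Set.mem_toFinset] at hu hv
    simp only [hu, hv, not_false_eq_true, dite_true]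
    congr 1
    refine ConnectedComponent.sound (Adj.reachable ?_)
    have := ((hT u).1 hu).2
    have := ((hT v).1 hv).2
    simp_all
  · intro i
    obtain ⟨c, rfl⟩ := hg i
    obtain ⟨⟨⟨v, hv⟩, hvH⟩, rfl⟩ := c.exists_rep
    have hvT : v ∉ T := (hT v).2 ⟨hv, hvH.2⟩
    refine ⟨v, by simpa using hvT, ?_⟩
    simp only [hvT, not_false_eq_true, dite_true]
    rfl

section Arithmetic

variable {a m s P : ℝ}

/-- The largest root of the characteristic cubic of the extremal graph, shifted by one. -/
lemma exists_root_cubic {M : ℝ} (ha : 1 ≤ a) (hM : 1 ≤ M) :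
    ∃ P, a + M < P ∧ (P - M - a) * P * (P - 1) = a * (P - M) := by
  let f : ℝ → ℝ := fun P => (P - M - a) * P * (P - 1) - a * (P - M)
  have hf : ContinuousOn f (Set.Icc (a + M) (a + M + 1)) := by
    unfold f
    fun_prop
  have h0 : (0 : ℝ) ∈ Set.Icc (f (a + M)) (f (a + M + 1)) := by
    constructor <;> simp only [f] <;> nlinarith
  obtain ⟨P, hP, h⟩ := intermediate_value_Icc (by linarith) hf h0
  simp only [f] at h
  refine ⟨P, lt_of_le_of_ne hP.1 ?_, by linarith⟩
  rintro rfl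
  nlinarith

lemma quotient_row_eq {M : ℝ} (ha : 1 ≤ a) (hM : 1 ≤ M) (hP : a + M < P)
    (h : (P - M - a) * P * (P - 1) = a * (P - M)) :
    (a - 1) + M * (a / (P - M)) + a / (P - 1) = P - 1 := by
  have h1 : P - M ≠ 0 := by linarith
  have h2 : P - 1 ≠ 0 := by linarith
  field_simp
  linarith

private lemma cubic_estimate_of_two_le (ha : 0 < a) (hm : 1 ≤ m) (hs : 2 ≤ s)
    (hP : a + (m + 2 * s) < P)
    (h : (P - (m + 2 * s) - a) * P * (P - 1) = a * (P - (m + 2 * s))) :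
    (a + s) * (s + 1) * (P - m) < (P - m - (a + s)) * P * (P - 1) := by
  obtain ⟨R, rfl⟩ : ∃ R, P = R + m := ⟨P - m, by ring⟩
  have hR : a + 2 * s < R := by linarith
  have h1 : (R + 1) * R ≤ (R + m) * (R + m - 1) := by nlinarith
  have h2 : 2 * a < R * (R - a - s) := by
    have : (a + 2 * s) * s ≤ R * (R - a - s) := by
      apply mul_le_mul <;> linarith
    nlinarith
  nlinarith

private lemma cubic_estimate_of_eq_one (ha : 1 ≤ a) (hm : m = 1 ∨ 2 ≤ m) (hP : a + (m + 2) < P)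
    (h : (P - (m + 2) - a) * P * (P - 1) = a * (P - (m + 2))) :
    (a + 1) * 2 * (P - m) < (P - m - (a + 1)) * P * (P - 1) := by
  obtain ⟨e, rfl⟩ : ∃ e, P = a + e + m + 2 := ⟨P - a - m - 2, by ring⟩
  have he : 0 < e := by linarith
  rcases hm with rfl | hm
  · by_contra! hcon
    have h1 : (a + 2 + e) * (1 + e) ≤ 2 * a := by nlinarith
    have h2 : (a + 2 + e) * (3 + e) ≤ 4 * a := by nlinarith
    have h3 : e * (a + 5 + e) ≤ a - 6 := by nlinarith
    have h4 : a * (a + e) * (a + 5 + e) ≤ (a - 6) * ((a + 2 + e) * (a + 3 + e)) := by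
      have := mul_le_mul_of_nonneg_right h3
        (show 0 ≤ (a + 2 + e) * (a + 3 + e) by positivity)
      nlinarith
    nlinarith
  · have h1 : (a + e + 4) * (a + e + 3) ≤ (a + e + m + 2) * (a + e + m + 2 - 1) := by
      apply mul_le_mul <;> linarith
    nlinarith

lemma cubic_estimate {s m : ℕ} (ha : 1 ≤ a) (hm : 1 ≤ m) (hs : 1 ≤ s)
    (hP : a + (m + 2 * s) < P)
    (h : (P - (m + 2 * s) - a) * P * (P - 1) = a * (P - (m + 2 * s))) :
    (a + s) * (s + 1) * (P - m) < (P - m - (a + s)) * P * (P - 1) := by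
  obtain rfl | hs := hs.eq_or_lt
  · have hm' : (m : ℝ) = 1 ∨ (2 : ℝ) ≤ m := by
      rcases hm.eq_or_lt with rfl | h'
      · simp
      · exact .inr (by exact_mod_cast h')
    simp only [Nat.cast_one, mul_one] at *
    convert! cubic_estimate_of_eq_one ha hm' hP h using 2
    norm_num
  · exact cubic_estimate_of_two_le (by linarith) (by exact_mod_cast hm) (by exact_mod_cast hs) hP h

lemma quotient_row_iff (hm : 1 ≤ m) (hP : m < P) :
    ((a + s - 1) + (a + s) * ((s + 2 + (m - 1) * (P / (P - m))) / (P - 1)) < P - 1 ↔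
      (a + s) * (s + 1) * (P - m) < (P - m - (a + s)) * P * (P - 1)) ∧
    ((a + s - 1) + (a + s) * ((s + 2 + (m - 1) * (P / (P - m))) / (P - 1)) = P - 1 ↔
      (a + s) * (s + 1) * (P - m) = (P - m - (a + s)) * P * (P - 1)) := by
  have h1 : 0 < P - m := by linarith
  have h2 : 0 < P - 1 := by linarith
  have key : (P - 1 - ((a + s - 1) + (a + s) * ((s + 2 + (m - 1) * (P / (P - m))) / (P - 1))))
      * ((P - m) * (P - 1))
      = (P - m - (a + s)) * P * (P - 1) - (a + s) * (s + 1) * (P - m) := by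
    field_simp
    ring
  have hpos := mul_pos h1 h2
  constructor
  · rw [← sub_pos, ← sub_pos (b := (a + s) * (s + 1) * (P - m)), ← key, mul_pos_iff_of_pos_right hpos]
  · rw [eq_comm, ← sub_eq_zero, eq_comm (a := (a + s) * (s + 1) * (P - m)),
      ← sub_eq_zero (b := (a + s) * (s + 1) * (P - m)), ← key, mul_eq_zero, or_iff_left hpos.ne']

lemma div_sub_le {c : ℝ} (hc : 1 ≤ c) (hcm : c ≤ m) (hP : m < P) :
    c / (P - c) ≤ (1 + (c - 1) * (P / (P - m))) / (P - 1) ∧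
    (c / (P - c) = (1 + (c - 1) * (P / (P - m))) / (P - 1) → c = 1 ∨ c = m) := by
  have h1 : 0 < P - m := by linarith
  have h2 : 0 < P - 1 := by linarith
  have h3 : 0 < P - c := by linarith
  have h4 : 0 < P := by linarith
  have key : (1 + (c - 1) * (P / (P - m))) / (P - 1) - c / (P - c)
      = (c - 1) * (m - c) * (P / ((P - m) * (P - c) * (P - 1))) := by
    field_simp
    ring
  have hpos : 0 < P / ((P - m) * (P - c) * (P - 1)) := by positivity
  constructor
  · rw [← sub_nonneg, key]
    exact mul_nonneg (mul_nonneg (by linarith) (by linarith)) hpos.le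
  · intro h
    rw [eq_comm, ← sub_eq_zero, key, mul_eq_zero, or_iff_left hpos.ne', mul_eq_zero, sub_eq_zero,
      sub_eq_zero] at h
    exact h.imp id Eq.symm

end Arithmetic

lemma sum_div_sub_le {s m : ℕ} {P : ℝ} {c : Fin (s + 2) → ℕ} (hc : ∀ i, 1 ≤ c i)
    (hsum : ∑ i, c i = s + 1 + m) (hP : m < P) :
    (∑ i, (c i : ℝ) / (P - c i) ≤ (s + 2 + (m - 1) * (P / (P - m))) / (P - 1)) ∧
    (∑ i, (c i : ℝ) / (P - c i) = (s + 2 + (m - 1) * (P / (P - m))) / (P - 1) →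
      ∀ i, c i = 1 ∨ c i = m) ∧ ∀ i, c i ≤ m := by
  have hcm : ∀ i, c i ≤ m := fun i => by
    have h : c i + (Finset.univ.erase i).sum c = ∑ i, c i :=
      Finset.add_sum_erase Finset.univ c (Finset.mem_univ i)
    have h' := Finset.card_nsmul_le_sum (Finset.univ.erase i) c 1 fun j _ => hc j
    simp at h'
    omega
  have hle := fun i => div_sub_le (P := P) (m := m) (c := c i)
    (by exact_mod_cast hc i) (by exact_mod_cast hcm i) hP
  have hR : ∑ i, (1 + ((c i : ℝ) - 1) * (P / (P - m))) / (P - 1)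
      = (s + 2 + (m - 1) * (P / (P - m))) / (P - 1) := by
    have hsum' : ∑ i, (c i : ℝ) = s + 1 + m := by exact_mod_cast hsum
    rw [← Finset.sum_div, Finset.sum_add_distrib, ← Finset.sum_mul, Finset.sum_sub_distrib, hsum']
    simp
    ring
  rw [← hR]
  refine ⟨Finset.sum_le_sum fun i _ => (hle i).1, fun h i => ?_, hcm⟩
  rw [Finset.sum_eq_sum_iff_of_le fun i _ => (hle i).1] at h
  exact_mod_cast (hle i).2 (h i (Finset.mem_univ i))

lemma gJoin_adj {α β : Type*} {G : SimpleGraph α} {H : SimpleGraph β} (x y : α ⊕ β) :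
    (gJoin G H).Adj x y ↔ (G ⊕g H).Adj x y ∨ (x.isLeft ∧ y.isRight) ∨ (y.isLeft ∧ x.isRight) := by
  rcases x with x | x <;> rcases y with y | y <;> simp [gJoin]

/-- `P - 1` is an eigenvalue of `K_a ∨ (K_M ∪ K_1)`. -/
lemma le_specRad_extremal {a M : ℕ} {P : ℝ} (ha : 1 ≤ a) (hM : 1 ≤ M) (hP : a + M < P)
    (h : (P - M - a) * P * (P - 1) = a * (P - M)) :
    P - 1 ≤ specRad (gJoin (⊤ : SimpleGraph (Fin a))
      ((⊤ : SimpleGraph (Fin M)) ⊕g (⊤ : SimpleGraph (Fin 1)))) := by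
  have ha' : (1 : ℝ) ≤ a := by exact_mod_cast ha
  have hM' : (1 : ℝ) ≤ M := by exact_mod_cast hM
  have hrow := quotient_row_eq ha' hM' hP h
  have h1 : P - M ≠ 0 := by linarith
  have h2 : P - 1 ≠ 0 := by linarith
  have hsum : ∀ {N : ℕ} (i : Fin N) (t : ℝ), ∑ j, (if i = j then 0 else t) = (N - 1) * t := by
    intro N i t
    have : ∀ j, (if i = j then 0 else t) = t - if i = j then t else 0 := fun j => by
      split_ifs <;> simp
    simp only [this, Finset.sum_sub_distrib]
    simp
    ring
  refine le_specRad
    (v := Sum.elim (fun _ => 1) (Sum.elim (fun _ => a / (P - M)) fun _ => a / (P - 1))) ?_ ?_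
  · intro h0
    simpa using congrFun h0 (Sum.inl ⟨0, ha⟩)
  · ext x
    rcases x with x | x | x
    · simp [adjSum, gJoin_adj, Fintype.sum_sum_type, hsum]
      linarith
    · simp [adjSum, gJoin_adj, Fintype.sum_sum_type, hsum]
      field_simp
      ring
    · obtain rfl := Subsingleton.elim x 0
      simp [adjSum, gJoin_adj, Fintype.sum_sum_type]
      field_simp

lemma nonempty_iso_extremal {V : Type*} [Fintype V] {G : SimpleGraph V} {a M : ℕ} (f : V → Fin 3)
    (h0 : Fintype.card {v // f v = 0} = a) (h1 : Fintype.card {v // f v = 1} = M)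
    (h2 : Fintype.card {v // f v = 2} = 1)
    (hadj : ∀ u v, G.Adj u v ↔ u ≠ v ∧ (f u = 0 ∨ f v = 0 ∨ f u = f v)) :
    Nonempty (G ≃g gJoin (⊤ : SimpleGraph (Fin a))
      ((⊤ : SimpleGraph (Fin M)) ⊕g (⊤ : SimpleGraph (Fin 1)))) := by
  let g : Fin a ⊕ (Fin M ⊕ Fin 1) → Fin 3 := Sum.elim (fun _ => 0) (Sum.elim (fun _ => 1) fun _ => 2)
  have hcard : ∀ c, Fintype.card {v // f v = c} = Fintype.card {x // g x = c} := by
    intro c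
    have : ∀ c, Fintype.card {x // g x = c} = ∑ x, if g x = c then 1 else 0 := fun c => by
      rw [Fintype.card_subtype, Finset.card_filter]
    rw [this, Fintype.sum_sum_type, Fintype.sum_sum_type]
    fin_cases c <;> simp [g, h0, h1, h2]
  let e := Equiv.ofFiberEquiv fun c => Fintype.equivOfCardEq (hcard c)
  have he : ∀ v, g (e v) = f v := Equiv.ofFiberEquiv_map _
  have hg : ∀ x y, (gJoin (⊤ : SimpleGraph (Fin a))
      ((⊤ : SimpleGraph (Fin M)) ⊕g (⊤ : SimpleGraph (Fin 1)))).Adj x y ↔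
      x ≠ y ∧ (g x = 0 ∨ g y = 0 ∨ g x = g y) := by
    rintro (x | x | x) (y | y | y) <;> simp [gJoin_adj, g]
  refine ⟨⟨e, fun {u v} => ?_⟩⟩
  rw [hg, hadj, he, he, e.injective.ne_iff]

/-- The graph in which the vertices of `T` are universal and the vertices outside `T` are adjacent
when they have the same colour. -/
def cliqueJoin {V ι : Type*} (T : Finset V) (col : V → ι) : SimpleGraph V where
  Adj u v := u ≠ v ∧ (u ∈ T ∨ v ∈ T ∨ col u = col v)
  symm := ⟨fun u v h => ⟨h.1.symm, by tauto⟩⟩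
  loopless := ⟨fun u h => h.1 rfl⟩

lemma adjSum_mono {V : Type*} [Fintype V] {G K : SimpleGraph V} (hGK : G ≤ K) {z : V → ℝ}
    (hz : ∀ i, 0 < z i) (i : V) : adjSum G z i ≤ adjSum K z i := by
  refine Finset.sum_le_sum fun j _ => ?_
  have := (hz j).le
  have := @hGK i j
  split_ifs <;> tauto

lemma eq_of_adjSum_eq {V : Type*} [Fintype V] {G K : SimpleGraph V} (hGK : G ≤ K) {z : V → ℝ}
    (hz : ∀ i, 0 < z i) (h : ∀ i, adjSum G z i = adjSum K z i) : G = K := by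
  classical
  refine le_antisymm hGK fun i j hij => ?_
  by_contra hG
  refine (Finset.sum_lt_sum (fun j _ => ?_) ⟨j, Finset.mem_univ j, ?_⟩).ne (h i)
  · have := (hz j).le
    have := @hGK i j
    split_ifs <;> tauto
  · rw [if_neg hG, if_pos hij]
    exact hz j

section CliqueJoin

variable {V ι : Type*} [Fintype V] [DecidableEq V] [DecidableEq ι]

/-- The weights `1` on `T` and `|T| / (P - c)` on a colour class of size `c` outside `T`. -/
noncomputable def cliqueJoinWeight (T : Finset V) (col : V → ι) (P : ℝ) (v : V) : ℝ :=
  if v ∈ T then 1 else T.card / (P - (Finset.univ.filter fun u => u ∉ T ∧ col u = col v).card)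

lemma adjSum_eq_sum_sub {G : SimpleGraph V} {z : V → ℝ} {v : V} {p : V → Prop} [DecidablePred p]
    (hv : p v) (hp : ∀ u, G.Adj v u ↔ v ≠ u ∧ p u) :
    adjSum G z v = (∑ u, if p u then z u else 0) - z v := by
  rw [adjSum, eq_sub_iff_add_eq]
  have : z v = ∑ u, if v = u then z u else 0 := by simp
  rw [this, ← Finset.sum_add_distrib]
  refine Finset.sum_congr rfl fun u _ => ?_
  by_cases h : v = u
  · subst h
    simp [hv]
  · simp [hp, h]

lemma adjSum_cliqueJoin_of_notMem {T : Finset V} {col : V → ι} {P : ℝ} {v : V} (hv : v ∉ T)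
    (hP : ((Finset.univ.filter fun u => u ∉ T ∧ col u = col v).card : ℝ) < P) :
    adjSum (cliqueJoin T col) (cliqueJoinWeight T col P) v
      = (P - 1) * cliqueJoinWeight T col P v := by
  rw [adjSum_eq_sum_sub (p := fun u => u ∈ T ∨ col v = col u) (Or.inr rfl)
    (by simp [cliqueJoin, hv])]
  have h : ∀ u, (if u ∈ T ∨ col v = col u then cliqueJoinWeight T col P u else 0)
      = (if u ∈ T then 1 else 0)
        + if u ∉ T ∧ col u = col v then cliqueJoinWeight T col P v else 0 := fun u => by
    by_cases hu : u ∈ T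
    · simp [hu, cliqueJoinWeight]
    · by_cases hc : col v = col u
      · simp [hu, hc, cliqueJoinWeight, hv]
      · simp [hu, hc, Ne.symm hc]
  rw [Finset.sum_congr rfl fun u _ => h u, Finset.sum_add_distrib, ← Finset.sum_filter,
    ← Finset.sum_filter, Finset.sum_const, Finset.sum_const]
  have h0 : P - (Finset.univ.filter fun u => u ∉ T ∧ col u = col v).card ≠ 0 := by linarith
  simp [cliqueJoinWeight, hv]
  field_simp
  ring

lemma adjSum_cliqueJoin_of_mem [Fintype ι] {T : Finset V} {col : V → ι} {P : ℝ} {v : V} (hv : v ∈ T) :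
    adjSum (cliqueJoin T col) (cliqueJoinWeight T col P) v
      = T.card - 1 + T.card * ∑ i, ((Finset.univ.filter fun u => u ∉ T ∧ col u = i).card : ℝ)
        / (P - (Finset.univ.filter fun u => u ∉ T ∧ col u = i).card) := by
  rw [adjSum_eq_sum_sub (p := fun _ => True) trivial (by simp [cliqueJoin, hv])]
  have h : ∀ u, (if True then cliqueJoinWeight T col P u else 0) = (if u ∈ T then 1 else 0)
      + ∑ i, if u ∉ T ∧ col u = i then
        (T.card : ℝ) / (P - (Finset.univ.filter fun u => u ∉ T ∧ col u = i).card) else 0 :=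
    fun u => by
      by_cases hu : u ∈ T <;> simp [hu, cliqueJoinWeight]
  rw [Finset.sum_congr rfl fun u _ => h u, Finset.sum_add_distrib, Finset.sum_comm,
    Finset.mul_sum]
  simp only [← Finset.sum_filter, Finset.sum_const, nsmul_eq_mul]
  have hf : (Finset.univ.filter fun u => u ∈ T) = T := by simp
  rw [hf, cliqueJoinWeight, if_pos hv, mul_one, add_sub_right_comm]
  congr 1
  refine Finset.sum_congr rfl fun i _ => ?_
  ring

end CliqueJoin

theorem spectral_k_extendable (k n : ℕ) (hk : 0 < k) (hn : 0 < n) (hnev : Even n)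
    (G : SimpleGraph (Fin n)) (hconn : G.Connected)
    (hrad : specRad (gJoin (⊤ : SimpleGraph (Fin (2 * k)))
      ((⊤ : SimpleGraph (Fin (n - 2 * k - 1))) ⊕g (⊤ : SimpleGraph (Fin 1)))) ≤ specRad G) :
    kExtendable G k ∨
    Nonempty (G ≃g gJoin (⊤ : SimpleGraph (Fin (2 * k)))
      ((⊤ : SimpleGraph (Fin (n - 2 * k - 1))) ⊕g (⊤ : SimpleGraph (Fin 1)))) := by
  classical
  by_cases hext : kExtendable G k
  · exact .inl hext
  refine .inr ?_
  simp only [kExtendable, not_forall] at hext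
  obtain ⟨M, hM, hMk, hno⟩ := hext
  obtain ⟨s, T, col, hT, hcol, hsurj⟩ :=
    exists_coloring_of_not_extends (by simpa using hnev) hM hno
  rw [hMk] at hT
  let c : Fin (s + 2) → ℕ := fun i => (Finset.univ.filter fun u => u ∉ T ∧ col u = i).card
  have hc : ∀ i, 1 ≤ c i := fun i => by
    obtain ⟨v, hv, hi⟩ := hsurj i
    exact Finset.card_pos.2 ⟨v, by simp [hv, hi]⟩
  have hcsum : T.card + ∑ i, c i = n := by
    have h1 := Finset.card_eq_sum_card_fiberwise (f := col) (s := Tᶜ) (t := Finset.univ)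
      (fun _ _ => Finset.mem_coe.2 (Finset.mem_univ _))
    have h2 := Finset.card_add_card_compl T
    rw [Fintype.card_fin, h1] at h2
    convert h2 using 4
    ext
    simp
  have hcge : s + 2 ≤ ∑ i, c i := by
    simpa using Finset.card_nsmul_le_sum Finset.univ c 1 fun i _ => hc i
  obtain ⟨m, hm⟩ : ∃ m, ∑ i, c i = s + 1 + m := ⟨_, (Nat.add_sub_of_le (by omega)).symm⟩
  have hm1 : 1 ≤ m := by omega
  have hMm : n - 2 * k - 1 = m + 2 * s := by omega
  have ha : (1 : ℝ) ≤ (2 * k : ℕ) := by exact_mod_cast (by omega : 1 ≤ 2 * k)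
  rw [hMm] at hrad ⊢
  obtain ⟨P, hP, hroot⟩ := exists_root_cubic ha
    (by exact_mod_cast (by omega : 1 ≤ m + 2 * s) : (1 : ℝ) ≤ (m + 2 * s : ℕ))
  have hθ := (le_specRad_extremal (by omega) (by omega) hP hroot).trans hrad
  have hs0 : (0 : ℝ) ≤ s := s.cast_nonneg
  have hm0 : (1 : ℝ) ≤ m := by exact_mod_cast hm1
  have hTr : (T.card : ℝ) = (2 * k : ℕ) + s := by exact_mod_cast hT
  set a : ℝ := ((2 * k : ℕ) : ℝ) with ha_def
  push_cast at hP hroot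
  have hmP : (m : ℝ) < P := by linarith
  obtain ⟨μ, hμ, v, hv, heig⟩ := exists_eigenvalue_ge (by linarith) hθ
  obtain ⟨hle, heq, hcm⟩ := sum_div_sub_le hc hm hmP
  have hcP : ∀ i, (c i : ℝ) < P := fun i => lt_of_le_of_lt (by exact_mod_cast hcm i) hmP
  set z := cliqueJoinWeight T col P with hz_def
  have hz : ∀ i, 0 < z i := fun i => by
    simp only [hz_def, cliqueJoinWeight]
    split_ifs
    · exact one_pos
    · exact div_pos (by linarith) (sub_pos.2 (hcP (col i)))
  have hGK : G ≤ cliqueJoin T col := fun u w h => ⟨h.ne, by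
    by_contra! hcon
    exact hcon.2.2 (hcol u w hcon.1 hcon.2.1 h)⟩
  have hbound : ∀ i ∈ T, adjSum (cliqueJoin T col) z i ≤
      (a + s - 1) + (a + s) * ((s + 2 + (m - 1) * (P / (P - m))) / (P - 1)) := fun i hi => by
    rw [adjSum_cliqueJoin_of_mem hi, hTr]
    gcongr
  obtain ⟨hlt_iff, heq_iff⟩ := quotient_row_iff (a := a) (s := s) hm0 hmP
  have hK : ∀ i, adjSum (cliqueJoin T col) z i ≤ (P - 1) * z i ∧
      (1 ≤ s → i ∈ T → adjSum (cliqueJoin T col) z i < (P - 1) * z i) := fun i => by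
    by_cases hi : i ∈ T
    · have hzi : z i = 1 := if_pos hi
      rw [hzi, mul_one]
      rcases Nat.eq_zero_or_pos s with rfl | hs
      · refine ⟨(hbound i hi).trans (heq_iff.2 ?_).le, by simp⟩
        push_cast at hroot ⊢
        linarith
      · have := (hbound i hi).trans_lt (hlt_iff.2 (cubic_estimate ha hm1 hs hP hroot))
        exact ⟨this.le, fun _ _ => this⟩
    · exact ⟨(adjSum_cliqueJoin_of_notMem hi (hcP (col i))).le, fun _ h => absurd h hi⟩
  have hG : ∀ i, adjSum G z i = (P - 1) * z i :=
    adjSum_eq_of_eigenvalue_ge hconn hz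
      (fun i => (adjSum_mono hGK hz i).trans (hK i).1) hv heig hμ
  have hGeq : G = cliqueJoin T col := eq_of_adjSum_eq hGK hz fun i =>
    le_antisymm (adjSum_mono hGK hz i) ((hK i).1.trans (hG i).ge)
  obtain ⟨t, ht⟩ : T.Nonempty := Finset.card_pos.1 (by omega)
  obtain rfl : s = 0 := by
    by_contra hs
    have h1 := (hK t).2 (by omega) ht
    have h2 := hG t
    rw [hGeq] at h2
    linarith
  have hsizes : ∀ i, c i = 1 ∨ c i = m := by
    refine heq (le_antisymm hle ?_)
    have h1 := hG t
    have hzt : z t = 1 := if_pos ht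
    rw [hGeq, adjSum_cliqueJoin_of_mem ht, hTr, hzt, mul_one, ← heq_iff.2 (by
      push_cast at hroot ⊢
      linarith)] at h1
    have h2 := add_left_cancel h1
    exact (mul_left_cancel₀ (by linarith) h2).ge
  obtain ⟨i, j, hij, hi, hj, hcover⟩ : ∃ i j : Fin 2, i ≠ j ∧ c i = m ∧ c j = 1 ∧
      ∀ l, l = i ∨ l = j := by
    rw [Fin.sum_univ_two] at hm
    rcases hsizes 0 with h | h
    · exact ⟨1, 0, by simp, by omega, h, by decide⟩
    · exact ⟨0, 1, by simp, h, by omega, by decide⟩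
  refine nonempty_iso_extremal (fun v => if v ∈ T then 0 else if col v = i then 1 else 2)
    ?_ ?_ ?_ ?_
  · rw [Fintype.card_subtype, ← add_zero (2 * k), ← hT]
    congr 1
    ext v
    simp
    grind
  · rw [Fintype.card_subtype, mul_zero, add_zero, ← hi]
    congr 1
    ext v
    simp
    grind
  · rw [Fintype.card_subtype, ← hj]
    congr 1
    ext v
    have := hcover (col v)
    simp
    grind
  · intro u w
    have := hcover (col u)
    have := hcover (col w)
    rw [hGeq]
    simp only [cliqueJoin]
    grind
end

section
/- Let n ≥ 10 be an even integer and G a connected graph on n vertices with minimum degree at least 2. If the adjacency spectral radius of G satisfies ρ(G) ≥ ρ(K_1 ∨ (K_2 ∪ K_{n-3})), then G is 1-excludable, unless G is isomorphic to K_1 ∨ (K_2 ∪ K_{n-3}). -/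
open SimpleGraph

/-- Every eigenvalue is at most `r` as soon as some positive vector `z` satisfies `A z ≤ r z`. -/
theorem eigenvalue_le_of_subharmonic {V : Type*} [Fintype V] (A : Matrix V V ℝ)
    (hA : ∀ i j, A i j = A j i) (hA0 : ∀ i j, 0 ≤ A i j) (z : V → ℝ) (hz : ∀ i, 0 < z i)
    (r : ℝ) (hr : 0 ≤ r) (h : ∀ i, ∑ j, A i j * z j ≤ r * z i)
    {μ : ℝ} {v : V → ℝ} (hv : v ≠ 0) (hμ : A.mulVec v = μ • v) : μ ≤ r := by
  rcases lt_or_ge μ 0 with h0 | h0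
  · linarith
  obtain ⟨i₀, hi₀⟩ := Function.ne_iff.1 hv
  have habs : ∀ i, μ * |v i| ≤ ∑ j, A i j * |v j| := by
    intro i
    have h1 : ∑ j, A i j * v j = μ * v i := by
      simpa [Matrix.mulVec, dotProduct] using congrFun hμ i
    calc μ * |v i| = |∑ j, A i j * v j| := by rw [h1, abs_mul, abs_of_nonneg h0]
      _ ≤ ∑ j, |A i j * v j| := Finset.abs_sum_le_sum_abs _ _
      _ = ∑ j, A i j * |v j| := by
        refine Finset.sum_congr rfl fun j _ => ?_
        rw [abs_mul, abs_of_nonneg (hA0 i j)]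
  have hpos : 0 < ∑ i, z i * |v i| :=
    Finset.sum_pos' (fun i _ => mul_nonneg (hz i).le (abs_nonneg _))
      ⟨i₀, Finset.mem_univ _, mul_pos (hz i₀) (abs_pos.2 hi₀)⟩
  have hle : μ * ∑ i, z i * |v i| ≤ r * ∑ i, z i * |v i| := by
    calc μ * ∑ i, z i * |v i| = ∑ i, z i * (μ * |v i|) := by
          rw [Finset.mul_sum]; exact Finset.sum_congr rfl fun _ _ => by ring
      _ ≤ ∑ i, z i * ∑ j, A i j * |v j| :=
          Finset.sum_le_sum fun i _ => mul_le_mul_of_nonneg_left (habs i) (hz i).le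
      _ = ∑ j, (∑ i, A j i * z i) * |v j| := by
          simp_rw [Finset.mul_sum, Finset.sum_mul]
          rw [Finset.sum_comm]
          refine Finset.sum_congr rfl fun i _ => Finset.sum_congr rfl fun j _ => ?_
          rw [hA i j]; ring
      _ ≤ ∑ j, (r * z j) * |v j| :=
          Finset.sum_le_sum fun j _ => mul_le_mul_of_nonneg_right (h j) (abs_nonneg _)
      _ = r * ∑ i, z i * |v i| := by
          rw [Finset.mul_sum]; exact Finset.sum_congr rfl fun _ _ => by ring
  exact le_of_mul_le_mul_right hle hpos

open scoped Classical in
theorem mem_upperBounds_of_subharmonic {V : Type*} [Fintype V] (G : SimpleGraph V)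
    (z : V → ℝ) (hz : ∀ i, 0 < z i) (r : ℝ) (hr : 0 ≤ r)
    (h : ∀ i, ∑ j ∈ G.neighborFinset i, z j ≤ r * z i) :
    r ∈ upperBounds {μ : ℝ | ∃ v : V → ℝ, v ≠ 0 ∧
      Matrix.mulVec (Matrix.of fun i j => if G.Adj i j then (1:ℝ) else 0) v = μ • v} := by
  rintro μ ⟨v, hv, hμ⟩
  refine eigenvalue_le_of_subharmonic _ (fun i j => ?_) (fun i j => ?_) z hz r hr (fun i => ?_)
    hv hμ
  · simp [G.adj_comm]
  · simp only [Matrix.of_apply]; split_ifs <;> norm_num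
  · convert h i using 1
    simp [Finset.sum_ite, SimpleGraph.neighborFinset_eq_filter]

open scoped Classical in
theorem specRad_le_of_subharmonic {V : Type*} [Fintype V] (G : SimpleGraph V)
    (z : V → ℝ) (hz : ∀ i, 0 < z i) (r : ℝ) (hr : 0 ≤ r)
    (h : ∀ i, ∑ j ∈ G.neighborFinset i, z j ≤ r * z i) : specRad G ≤ r :=
  Real.sSup_le (mem_upperBounds_of_subharmonic G z hz r hr h) hr

open scoped Classical in
theorem le_specRad_of_eigenvector {V : Type*} [Fintype V] (G : SimpleGraph V) (μ : ℝ) (v : V → ℝ)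
    (hv : v ≠ 0) (h : ∀ i, ∑ j, (if G.Adj i j then v j else 0) = μ * v i) : μ ≤ specRad G := by
  refine le_csSup ⟨Fintype.card V, mem_upperBounds_of_subharmonic G (fun _ => 1)
    (fun _ => one_pos) _ (Nat.cast_nonneg _) fun i => ?_⟩ ⟨v, hv, ?_⟩
  · simpa using (G.degree_lt_card_verts i).le
  · ext i
    simpa [Matrix.mulVec, dotProduct] using h i

/-- The spectral radius of `K₁ ∨ (K₂ ∪ Kₘ)` exceeds `m`. -/
theorem lt_specRad_join (m : ℕ) (hm : 2 ≤ m) :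
    (m : ℝ) < specRad (gJoin (⊤ : SimpleGraph (Fin 1))
      ((⊤ : SimpleGraph (Fin 2)) ⊕g (⊤ : SimpleGraph (Fin m)))) := by
  have hm' : (2 : ℝ) ≤ m := by exact_mod_cast hm
  obtain ⟨t, ⟨ht1, -⟩, ht⟩ : (0 : ℝ) ∈
      (fun t : ℝ => t * (t - 1) * (t - m + 1) - 2 * (t - m + 1) - m * (t - 1)) ''
        Set.Ioo (m : ℝ) (m + 1) := by
    refine intermediate_value_Ioo (by linarith) (by fun_prop) ⟨?_, ?_⟩
    · nlinarith
    · nlinarith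
  refine ht1.trans_le ?_
  refine le_specRad_of_eigenvector _ t
    (Sum.elim (fun _ => (t - 1) * (t - m + 1)) (Sum.elim (fun _ => t - m + 1) fun _ => t - 1))
    (Function.ne_iff.2 ⟨Sum.inl 0, ?_⟩) ?_
  · have h1 : 0 < t - 1 := by linarith
    have h2 : 0 < t - m + 1 := by linarith
    exact (mul_pos h1 h2).ne'
  · rintro (i | i | i)
    · simp [gJoin, Subsingleton.elim i 0]
      linarith
    · have : ∀ c : ℝ, (∑ j : Fin 2, if i = j then 0 else c) = c := by
        intro c; fin_cases i <;> simp
      simp [gJoin, this]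
      ring
    · have : ∀ c : ℝ, (∑ j : Fin m, if i = j then 0 else c) = (m - 1) * c := by
        intro c
        simp [Finset.sum_ite, Finset.filter_ne, Finset.card_erase_of_mem]
        left; rw [Nat.cast_sub (by omega)]; simp
      simp [gJoin, this]
      ring

/-- Tutte's theorem with parity: a graph of even order without perfect matching has a vertex set `S`
whose removal leaves at least `|S| + 2` connected components; `f` chooses a representative of the
component of each vertex outside `S`. -/
theorem exists_separating_of_no_perfectMatching {V : Type*} [Fintype V] [DecidableEq V]
    (H : SimpleGraph V) (heven : Even (Fintype.card V))
    (h : ¬ ∃ M : H.Subgraph, M.IsPerfectMatching) :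
    ∃ (S : Finset V) (f : V → V), (∀ u v, u ∉ S → v ∉ S → H.Adj u v → f u = f v) ∧
      S.card + 2 ≤ (Sᶜ.image f).card := by
  classical
  rw [SimpleGraph.tutte] at h
  push Not at h
  obtain ⟨u, hu⟩ := h
  set K := ((⊤ : H.Subgraph).deleteVerts u).coe with hK
  have hmem : ∀ v, v ∉ u.toFinset → v ∈ ((⊤ : H.Subgraph).deleteVerts u).verts := by
    intro v hv; simpa using hv
  refine ⟨u.toFinset, fun v => if hv : v ∉ u.toFinset then
    ((K.connectedComponentMk ⟨v, hmem v hv⟩).out : V) else v, ?_, ?_⟩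
  · intro a b ha hb hab
    have hadj : K.Adj ⟨a, hmem a ha⟩ ⟨b, hmem b hb⟩ := by
      simp only [hK, SimpleGraph.Subgraph.coe_adj, SimpleGraph.Subgraph.deleteVerts_adj]
      simpa using ⟨by simpa using ha, by simpa using hb, hab⟩
    simp only [ha, hb, not_false_eq_true, dite_true]
    rw [SimpleGraph.ConnectedComponent.connectedComponentMk_eq_of_adj hadj]
  · have hcard : Nat.card ((⊤ : H.Subgraph).deleteVerts u).verts + u.ncard = Fintype.card V := by
      rw [Nat.card_coe_set_eq, SimpleGraph.Subgraph.deleteVerts_verts, SimpleGraph.Subgraph.verts_top,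
        ← Set.compl_eq_univ_sdiff, add_comm, Set.ncard_add_ncard_compl, Nat.card_eq_fintype_card]
    have hpar := K.odd_ncard_oddComponents
    have hlt : u.ncard < K.oddComponents.ncard := hu
    have hle : K.oddComponents.ncard ≤ (u.toFinsetᶜ.image fun v => if hv : v ∉ u.toFinset then
        ((K.connectedComponentMk ⟨v, hmem v hv⟩).out : V) else v).card := by
      rw [← Set.ncard_coe_finset]
      refine Set.ncard_le_ncard_of_injOn (fun c => (c.out : V)) ?_ ?_ (Finset.finite_toSet _)
      · intro c _
        have hc : (c.out : V) ∉ u.toFinset := by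
          have := c.out.2
          simpa using this
        simp only [Finset.coe_image, Set.mem_image]
        refine ⟨c.out, by simpa using hc, ?_⟩
        simp only [hc, not_false_eq_true, dite_true]
        congr 2
        exact Quot.out_eq c
      · intro c _ d _ hcd
        rw [← Quot.out_eq c, ← Quot.out_eq d, Subtype.ext hcd]
    have hs : u.toFinset.card = u.ncard := (Set.ncard_eq_toFinset_card' u).symm
    rw [Nat.odd_iff, Nat.odd_iff] at hpar
    rw [Nat.even_iff] at heven
    omega

/-- If all fibres of `f` over a finset `T` have size between `L` and `M`, the sum of the squares of
the fibre sizes is bounded by convexity, with a gain from any fibre of intermediate size. -/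
theorem sum_card_fiber_add_le {α β : Type*} [DecidableEq β] (T : Finset α) (f : α → β) (L M k : ℤ)
    (hL0 : 0 ≤ L) (hM0 : 0 ≤ M)
    (hL : ∀ v ∈ T, L ≤ ((T.filter fun u => f u = f v).card : ℤ))
    (hM : ∀ v ∈ T, ((T.filter fun u => f u = f v).card : ℤ) ≤ M)
    (hk : k ≤ ((T.image f).card : ℤ)) {v : α} (hv : v ∈ T) :
    ∑ v ∈ T, ((T.filter fun u => f u = f v).card : ℤ) +
      (((T.filter fun u => f u = f v).card : ℤ) - L) *
        (M - ((T.filter fun u => f u = f v).card : ℤ)) ≤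
      (L + M) * T.card - k * (L * M) := by
  have h1 := Finset.sum_comp (s := T) (fun b => ((T.filter fun u => f u = b).card : ℤ)) f
  have h2 : (T.card : ℤ) = ∑ b ∈ T.image f, ((T.filter fun u => f u = b).card : ℤ) := by
    exact_mod_cast Finset.card_eq_sum_card_image f T
  have h3 := Finset.single_le_sum (s := T.image f)
    (f := fun b => (((T.filter fun u => f u = b).card : ℤ) - L) *
        (M - ((T.filter fun u => f u = b).card : ℤ)))
    (fun b hb => by
      obtain ⟨v, hv, rfl⟩ := Finset.mem_image.1 hb
      exact mul_nonneg (sub_nonneg.2 (hL v hv)) (sub_nonneg.2 (hM v hv)))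
    (Finset.mem_image_of_mem f hv)
  have h4 : ∑ b ∈ T.image f, (((T.filter fun u => f u = b).card : ℤ) - L) *
        (M - ((T.filter fun u => f u = b).card : ℤ)) =
      (L + M) * T.card - (T.image f).card * (L * M) -
        ∑ v ∈ T, ((T.filter fun u => f u = f v).card : ℤ) := by
    rw [h1, h2, Finset.mul_sum, ← nsmul_eq_mul, ← Finset.sum_const, ← Finset.sum_sub_distrib,
      ← Finset.sum_sub_distrib]
    refine Finset.sum_congr rfl fun b _ => ?_
    rw [nsmul_eq_mul]
    ring
  have h5 := mul_le_mul_of_nonneg_right hk (mul_nonneg hL0 hM0)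
  linarith

theorem card_fiber_add_card_fiber_le {α β : Type*} [DecidableEq α] [DecidableEq β] (T : Finset α)
    (f : α → β) {u v : α} (huv : f u ≠ f v) :
    (T.filter fun t => f t = f u).card + (T.filter fun t => f t = f v).card ≤ T.card := by
  rw [← Finset.card_union_of_disjoint]
  · exact Finset.card_le_card
      (Finset.union_subset (Finset.filter_subset _ _) (Finset.filter_subset _ _))
  · rw [Finset.disjoint_filter]
    exact fun t _ h1 h2 => huv (h1.symm.trans h2)

theorem card_image_add_card_fiber_le {α β : Type*} [DecidableEq β] (T : Finset α) (f : α → β)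
    (v : α) : (T.image f).card + (T.filter fun t => f t = f v).card ≤ T.card + 1 := by
  classical
  have h1 : T.image f ⊆ insert (f v) ((T.filter fun t => ¬ f t = f v).image f) := by
    intro b hb
    obtain ⟨t, ht, rfl⟩ := Finset.mem_image.1 hb
    by_cases h : f t = f v
    · simp [h]
    · exact Finset.mem_insert_of_mem (Finset.mem_image_of_mem f (by simp [ht, h]))
  have h2 := (Finset.card_le_card h1).trans (Finset.card_insert_le _ _)
  have h3 : ((T.filter fun t => ¬ f t = f v).image f).card ≤ _ := Finset.card_image_le
  have h4 := Finset.card_filter_add_card_filter_not (s := T) (fun t => f t = f v)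
  omega

open scoped Classical in
theorem sum_neighbor_degrees_le {V : Type*} [Fintype V] (G : SimpleGraph V)
    (hdeg : ∀ v, 2 ≤ G.degree v) (v : V) :
    (∑ u ∈ G.neighborFinset v, (G.degree u : ℤ)) - G.degree v ≤
      ∑ u, (G.degree u : ℤ) - 2 * (Fintype.card V - 1) := by
  have hv : v ∉ G.neighborFinset v := by simp
  have h1 := Finset.sum_add_sum_compl (insert v (G.neighborFinset v)) fun u => (G.degree u : ℤ)
  rw [Finset.sum_insert hv] at h1
  have h2 : ((insert v (G.neighborFinset v))ᶜ.card : ℤ) * 2 ≤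
      ∑ u ∈ (insert v (G.neighborFinset v))ᶜ, (G.degree u : ℤ) := by
    have := Finset.card_nsmul_le_sum (insert v (G.neighborFinset v))ᶜ
      (fun u => (G.degree u : ℤ)) 2 fun u _ => by exact_mod_cast hdeg u
    simpa using this
  have h3 := Finset.card_compl_add_card (insert v (G.neighborFinset v))
  rw [Finset.card_insert_of_notMem hv, SimpleGraph.card_neighborFinset_eq_degree] at h3
  have h4 : ((insert v (G.neighborFinset v))ᶜ.card : ℤ) + (G.degree v + 1) = Fintype.card V := by
    exact_mod_cast h3
  linarith

open scoped Classical in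
/-- A graph of minimum degree two whose spectral radius exceeds `n - 3` has many edges. -/
theorem le_sum_degrees_of_lt_specRad {V : Type*} [Fintype V] (G : SimpleGraph V)
    (hn : 10 ≤ Fintype.card V) (hdeg : ∀ v, 2 ≤ G.degree v)
    (hrad : (Fintype.card V : ℝ) - 3 < specRad G) :
    (Fintype.card V : ℤ) ^ 2 - 5 * Fintype.card V + 12 ≤ ∑ u, (G.degree u : ℤ) := by
  set n := Fintype.card V with hn_def
  by_contra! hlt
  have hn' : (10 : ℝ) ≤ n := by exact_mod_cast hn
  have hpar : ∑ u, (G.degree u : ℤ) ≤ (n : ℤ) ^ 2 - 5 * n + 10 := by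
    have h1 : ∑ u, (G.degree u : ℤ) = 2 * G.edgeFinset.card := by
      exact_mod_cast G.sum_degrees_eq_twice_card_edges
    have h2 : Even ((n : ℤ) ^ 2 - 5 * n) := by
      have : (n : ℤ) ^ 2 - 5 * n = n * (n + 1) - 2 * (3 * n) := by ring
      rw [this]
      exact (Int.even_mul_succ_self _).sub (even_two_mul _)
    obtain ⟨c, hc⟩ := h2
    omega
  refine absurd (specRad_le_of_subharmonic G (fun v => (G.degree v : ℝ) + (n - 4))
    (fun v => ?_) ((n : ℝ) - 3) (by linarith) fun v => ?_) (not_le.2 hrad)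
  · have : (0 : ℝ) ≤ G.degree v := Nat.cast_nonneg _
    linarith
  · have h1 : ((∑ u ∈ G.neighborFinset v, (G.degree u : ℤ)) - G.degree v : ℤ) ≤
        (n - 3) * (n - 4) := by
      have := sum_neighbor_degrees_le G hdeg v
      nlinarith
    have h2 : (∑ u ∈ G.neighborFinset v, (G.degree u : ℝ)) - G.degree v ≤
        (n - 3) * (n - 4) := by exact_mod_cast h1
    rw [Finset.sum_add_distrib, Finset.sum_const, SimpleGraph.card_neighborFinset_eq_degree,
      nsmul_eq_mul]
    linarith

/-- A graph of order `m + 3` with enough edges, in which the adjacent vertices `a` and `b` have no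
neighbours but each other and `w`, is `K₁ ∨ (K₂ ∪ Kₘ)`. -/
theorem nonempty_iso_join {V : Type*} [Fintype V] [DecidableEq V] (G : SimpleGraph V) (m : ℕ)
    (hcard : Fintype.card V = m + 3) (w a b : V) (hwa : w ≠ a) (hwb : w ≠ b) (hab : a ≠ b)
    (ha : ∀ v, G.Adj a v ↔ v = b ∨ v = w) (hb : ∀ v, G.Adj b v ↔ v = a ∨ v = w)
    (hG : ∀ u v, u ≠ a → u ≠ b → v ≠ a → v ≠ b → u ≠ v → G.Adj u v) :
    Nonempty (G ≃g gJoin (⊤ : SimpleGraph (Fin 1))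
      ((⊤ : SimpleGraph (Fin 2)) ⊕g (⊤ : SimpleGraph (Fin m)))) := by
  obtain ⟨g, hg⟩ := Finset.exists_equiv_extend_of_card_eq
    (α := Fin 1 ⊕ (Fin 2 ⊕ Fin m)) (t := (Finset.univ : Finset V))
    (by simp [hcard]; ring)
    (s := {Sum.inl 0, Sum.inr (Sum.inl 0), Sum.inr (Sum.inl 1)})
    (f := Sum.elim (fun _ => w) (Sum.elim ![a, b] fun _ => w)) (by simp)
    (by
      intro x hx y hy hxy
      simp only [Finset.coe_insert, Finset.coe_singleton, Set.mem_insert_iff,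
        Set.mem_singleton_iff] at hx hy
      rcases hx with rfl | rfl | rfl <;> rcases hy with rfl | rfl | rfl <;>
        simp_all [eq_comm])
  let e : Fin 1 ⊕ (Fin 2 ⊕ Fin m) ≃ V := g.trans (Equiv.subtypeUnivEquiv fun _ => Finset.mem_univ _)
  have hew : e (Sum.inl 0) = w := hg _ (by simp)
  have hea : e (Sum.inr (Sum.inl 0)) = a := hg _ (by simp)
  have heb : e (Sum.inr (Sum.inl 1)) = b := hg _ (by simp)
  have hne : ∀ i, e (Sum.inr (Sum.inr i)) ≠ a ∧ e (Sum.inr (Sum.inr i)) ≠ b ∧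
      e (Sum.inr (Sum.inr i)) ≠ w := by
    intro i
    rw [← hew, ← hea, ← heb]
    simp
  refine ⟨SimpleGraph.Iso.symm ⟨e, ?_⟩⟩
  have key : ∀ i j, G.Adj w (e (Sum.inr (Sum.inr i))) ∧
      (G.Adj (e (Sum.inr (Sum.inr i))) (e (Sum.inr (Sum.inr j))) ↔ i ≠ j) := by
    intro i j
    refine ⟨hG _ _ hwa hwb (hne i).1 (hne i).2.1 (hne i).2.2.symm, fun h hij => ?_, fun h => ?_⟩
    · subst hij; exact G.irrefl h
    · exact hG _ _ (hne i).1 (hne i).2.1 (hne j).1 (hne j).2.1 (by simpa using h)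
  have h2 : ∀ i : Fin 2, i = 0 ∨ i = 1 := by decide
  rintro (i | i | i) (j | j | j)
  · simp [Subsingleton.elim i j, gJoin]
  · rw [Subsingleton.elim i 0, hew]
    rcases h2 j with rfl | rfl
    · rw [hea, G.adj_comm, ha]; simp [gJoin]
    · rw [heb, G.adj_comm, hb]; simp [gJoin]
  · rw [Subsingleton.elim i 0, hew]
    simp [gJoin, (key j j).1]
  · rw [Subsingleton.elim j 0, hew]
    rcases h2 i with rfl | rfl
    · rw [hea, ha]; simp [gJoin]
    · rw [heb, hb]; simp [gJoin]
  · rcases h2 i with rfl | rfl <;> rcases h2 j with rfl | rfl <;>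
      simp [hea, heb, gJoin, ha, hb, hwa.symm, hwb.symm]
  · rcases h2 i with rfl | rfl
    · rw [hea, ha]; simp [gJoin, hne j]
    · rw [heb, hb]; simp [gJoin, hne j]
  · rw [Subsingleton.elim j 0, hew, G.adj_comm]
    simp [gJoin, (key i i).1]
  · rcases h2 j with rfl | rfl
    · rw [hea, G.adj_comm, ha]; simp [gJoin, hne i]
    · rw [heb, G.adj_comm, hb]; simp [gJoin, hne i]
  · rw [(key i j).2]; simp [gJoin]

open scoped Classical in
theorem nonempty_iso_join_of_le_sum_degrees {V : Type*} [Fintype V] (G : SimpleGraph V)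
    (hn : 10 ≤ Fintype.card V)
    (hsum : (Fintype.card V : ℤ) ^ 2 - 5 * Fintype.card V + 12 ≤ ∑ u, (G.degree u : ℤ))
    (w a b : V) (hwa : w ≠ a) (hwb : w ≠ b) (hab : a ≠ b)
    (ha : ∀ v, G.Adj a v ↔ v = b ∨ v = w) (hb : ∀ v, G.Adj b v ↔ v = a ∨ v = w) :
    Nonempty (G ≃g gJoin (⊤ : SimpleGraph (Fin 1))
      ((⊤ : SimpleGraph (Fin 2)) ⊕g (⊤ : SimpleGraph (Fin (Fintype.card V - 3))))) := by
  refine nonempty_iso_join G _ (by omega) w a b hwa hwb hab ha hb ?_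
  let B : V → Finset V := fun u =>
    if u = a then {b, w} else if u = b then {a, w} else if u = w then {w}ᶜ else {u, a, b}ᶜ
  have hB : ∀ u, G.neighborFinset u ⊆ B u := by
    intro u v hv
    rw [SimpleGraph.mem_neighborFinset] at hv
    have h1 : u = a → v = b ∨ v = w := by rintro rfl; exact (ha v).1 hv
    have h2 : u = b → v = a ∨ v = w := by rintro rfl; exact (hb v).1 hv
    have h3 : v = a → u = b ∨ u = w := by rintro rfl; exact (ha u).1 hv.symm
    have h4 : v = b → u = a ∨ u = w := by rintro rfl; exact (hb u).1 hv.symm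
    have h5 := hv.ne
    simp only [B]
    split_ifs <;> simp <;> grind
  have hcard : ∀ u, ((B u).card : ℤ) = (Fintype.card V - 3) -
      (if u = a then (Fintype.card V : ℤ) - 5 else 0)
      - (if u = b then (Fintype.card V : ℤ) - 5 else 0) + (if u = w then 2 else 0) := by
    intro u
    have h1 : (({w}ᶜ : Finset V).card : ℤ) = Fintype.card V - 1 := by
      rw [Finset.card_compl, Finset.card_singleton]; omega
    have h2 : u ≠ a → u ≠ b → ((({u, a, b} : Finset V)ᶜ).card : ℤ) = Fintype.card V - 3 := by
      intro h h'
      rw [Finset.card_compl, Finset.card_eq_three.2 ⟨u, a, b, h, h', hab, rfl⟩]; omega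
    by_cases hua : u = a
    · subst hua
      simp [B, hab, hwa.symm, Finset.card_pair hwb.symm]
    by_cases hub : u = b
    · subst hub
      simp [B, hab.symm, hwb.symm, Finset.card_pair hwa.symm]
    by_cases huw : u = w
    · subst huw
      simp only [B, hua, hub, if_false, if_true, h1]; ring
    · simp only [B, hua, hub, huw, if_false, h2 hua hub]; ring
  have htot : ∑ u, ((B u).card : ℤ) = (Fintype.card V : ℤ) ^ 2 - 5 * Fintype.card V + 12 := by
    simp only [hcard, Finset.sum_add_distrib, Finset.sum_sub_distrib, Finset.sum_ite_eq',
      Finset.mem_univ, if_true, Finset.sum_const, Finset.card_univ, nsmul_eq_mul]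
    ring
  have hle : ∀ u ∈ Finset.univ, (G.degree u : ℤ) ≤ (B u).card := by
    intro u _
    rw [← SimpleGraph.card_neighborFinset_eq_degree]
    exact_mod_cast Finset.card_le_card (hB u)
  have heq := (Finset.sum_eq_sum_iff_of_le hle).1
    (le_antisymm (Finset.sum_le_sum hle) (htot.trans_le hsum))
  have hBeq : ∀ u, G.neighborFinset u = B u := by
    intro u
    refine Finset.eq_of_subset_of_card_le (hB u) ?_
    rw [SimpleGraph.card_neighborFinset_eq_degree]
    exact_mod_cast (heq u (Finset.mem_univ _)).ge
  intro u v hua hub hva hvb huv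
  rw [← SimpleGraph.mem_neighborFinset, hBeq]
  simp only [B, hua, hub, if_false]
  split_ifs with h
  · subst h; simpa using huv.symm
  · simp [hva, hvb, huv.symm]

open scoped Classical in
/-- Outside `S`, the only edge joining different fibres of `f` is (at most) `xy`. -/
theorem neighborFinset_subset_of_separating {V : Type*} [Fintype V] (G : SimpleGraph V)
    (S : Finset V) (f : V → V) (x y : V)
    (hf : ∀ u v, u ∉ S → v ∉ S → G.Adj u v → s(u, v) ≠ s(x, y) → f u = f v)
    {v : V} (hv : v ∉ S) :
    G.neighborFinset v ⊆ (S ∪ (Sᶜ.filter fun u => f u = f v).erase v) ∪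
      (if v = x then {y} else if v = y then {x} else ∅) := by
  intro u hu
  rw [SimpleGraph.mem_neighborFinset] at hu
  by_cases huS : u ∈ S
  · simp [huS]
  by_cases he : s(u, v) = s(x, y)
  · rw [Sym2.eq_iff] at he
    rcases he with ⟨rfl, rfl⟩ | ⟨rfl, rfl⟩
    · simp [hu.ne]
    · simp
  · have := hf u v huS hv hu.symm he
    simp [huS, this, hu.ne']

open scoped Classical in
theorem degree_le_of_separating {V : Type*} [Fintype V] (G : SimpleGraph V)
    (S : Finset V) (f : V → V) (x y : V)
    (hf : ∀ u v, u ∉ S → v ∉ S → G.Adj u v → s(u, v) ≠ s(x, y) → f u = f v)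
    {v : V} (hv : v ∉ S) :
    (G.degree v : ℤ) ≤ S.card + ((Sᶜ.filter fun u => f u = f v).card - 1) +
      ((if v = x then 1 else 0) + if v = y then 1 else 0) := by
  have h1 := Finset.card_le_card (neighborFinset_subset_of_separating G S f x y hf hv)
  rw [SimpleGraph.card_neighborFinset_eq_degree] at h1
  have h2 := h1.trans (Finset.card_union_le _ _)
  have h3 := Finset.card_union_le S ((Sᶜ.filter fun u => f u = f v).erase v)
  have h4 := Finset.card_erase_add_one (s := Sᶜ.filter fun u => f u = f v) (a := v) (by simp [hv])
  have h5 : ((if v = x then {y} else if v = y then {x} else ∅ : Finset V).card : ℤ) ≤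
      (if v = x then 1 else 0) + if v = y then 1 else 0 := by
    split_ifs <;> simp
  omega

open scoped Classical in
theorem sum_degrees_le_of_separating {V : Type*} [Fintype V] (G : SimpleGraph V)
    (S : Finset V) (f : V → V) (x y : V)
    (hf : ∀ u v, u ∉ S → v ∉ S → G.Adj u v → s(u, v) ≠ s(x, y) → f u = f v) :
    ∑ v, (G.degree v : ℤ) ≤ S.card * (Fintype.card V - 1) +
      (Fintype.card V - S.card) * (S.card - 1) +
      ∑ v ∈ Sᶜ, ((Sᶜ.filter fun u => f u = f v).card : ℤ) + 2 := by
  have h1 : ∑ v ∈ S, (G.degree v : ℤ) ≤ S.card * (Fintype.card V - 1) := by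
    rw [← nsmul_eq_mul]
    refine Finset.sum_le_card_nsmul _ _ _ fun v _ => ?_
    have := G.degree_lt_card_verts v
    omega
  have h2 : ∑ v ∈ Sᶜ, (G.degree v : ℤ) ≤ _ := Finset.sum_le_sum fun v hv =>
    degree_le_of_separating G S f x y hf (by simpa using hv)
  have h3 : ∀ z : V, ∑ v ∈ Sᶜ, (if v = z then (1 : ℤ) else 0) ≤ 1 := by
    intro z
    rw [Finset.sum_ite_eq']
    split_ifs <;> norm_num
  have h4 : ((Sᶜ.card : ℕ) : ℤ) = Fintype.card V - S.card := by
    have := Finset.card_compl_add_card S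
    omega
  rw [Finset.sum_add_distrib, Finset.sum_add_distrib, Finset.sum_add_distrib, Finset.sum_sub_distrib,
    Finset.sum_const, Finset.sum_const, nsmul_eq_mul, nsmul_eq_mul, h4] at h2
  rw [← Finset.sum_add_sum_compl S]
  linarith [h3 x, h3 y]

open scoped Classical in
/-- The extremal configuration when more than one vertex is removed has ten vertices; it is excluded
by an explicit test vector. -/
theorem specRad_le_seven {V : Type*} [Fintype V] (G : SimpleGraph V)
    (hn : Fintype.card V = 10) (S : Finset V) (hS : S.card = 4) (f : V → V) (x y : V)
    (hf : ∀ u v, u ∉ S → v ∉ S → G.Adj u v → s(u, v) ≠ s(x, y) → f u = f v)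
    (hk : S.card + 2 ≤ (Sᶜ.image f).card) : specRad G ≤ 7 := by
  have hScard : Sᶜ.card = 6 := by rw [Finset.card_compl, hn, hS]
  have htot : ∑ u : V, (if u ∈ S then (3 : ℝ) else 2) = 24 := by
    have h1 : (Finset.univ.filter fun u => u ∈ S) = S := by ext; simp
    have h2 : (Finset.univ.filter fun u => u ∉ S) = Sᶜ := by ext; simp
    rw [Finset.sum_ite, h1, h2, Finset.sum_const, Finset.sum_const, hS, hScard]
    norm_num
  refine specRad_le_of_subharmonic G (fun u => if u ∈ S then 3 else 2)
    (fun u => by split_ifs <;> norm_num) 7 (by norm_num) fun v => ?_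
  have hpos : ∀ u : V, (0 : ℝ) ≤ if u ∈ S then 3 else 2 := fun u => by split_ifs <;> norm_num
  by_cases hv : v ∈ S
  · have h1 := Finset.sum_le_sum_of_subset_of_nonneg
      (show G.neighborFinset v ⊆ Finset.univ.erase v by intro u; simp; exact fun h => h.ne')
      (fun u _ _ => hpos u)
    have h2 := Finset.add_sum_erase Finset.univ (fun u => if u ∈ S then (3 : ℝ) else 2)
      (Finset.mem_univ v)
    rw [htot] at h2
    simp only [hv, if_true] at h2 ⊢
    linarith
  · have h1 : (Sᶜ.filter fun u => f u = f v).erase v = ∅ := by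
      rw [← Finset.card_eq_zero, Finset.card_erase_of_mem (by simp [hv])]
      have := card_image_add_card_fiber_le Sᶜ f v
      omega
    have h2 := neighborFinset_subset_of_separating G S f x y hf hv
    rw [h1, Finset.union_empty] at h2
    have h3 : ∑ u ∈ S, (if u ∈ S then (3 : ℝ) else 2) = 12 := by
      rw [Finset.sum_congr rfl fun u hu => if_pos hu, Finset.sum_const, hS]; norm_num
    have h4 : ∑ u ∈ G.neighborFinset v \ S, (if u ∈ S then (3 : ℝ) else 2) ≤ 2 := by
      have hc : (G.neighborFinset v \ S).card ≤ 1 := by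
        refine (Finset.card_le_card (sdiff_le_iff.2 h2)).trans ?_
        split_ifs <;> simp
      rw [Finset.sum_congr rfl fun u hu => if_neg (Finset.mem_sdiff.1 hu).2, Finset.sum_const,
        nsmul_eq_mul]
      have : ((G.neighborFinset v \ S).card : ℝ) ≤ 1 := by exact_mod_cast hc
      linarith
    have h5 := Finset.sum_le_sum_of_subset_of_nonneg
      (show G.neighborFinset v ⊆ S ∪ (G.neighborFinset v \ S) by
        intro u hu; by_cases h : u ∈ S <;> simp_all)
      (fun u _ _ => hpos u)
    rw [Finset.sum_union Finset.disjoint_sdiff] at h5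
    simp only [hv, if_false]
    linarith

open scoped Classical in
/-- A single edge cannot separate a graph of minimum degree two with many edges. -/
theorem sum_degrees_lt_of_separating_empty {V : Type*} [Fintype V] (G : SimpleGraph V)
    (hn : 10 ≤ Fintype.card V) (hdeg : ∀ v, 2 ≤ G.degree v) (f : V → V) (x y : V) (hxy : x ≠ y)
    (hf : ∀ u v, G.Adj u v → s(u, v) ≠ s(x, y) → f u = f v)
    (hk : 2 ≤ (Finset.univ.image f).card) :
    ∑ u, (G.degree u : ℤ) < (Fintype.card V : ℤ) ^ 2 - 5 * Fintype.card V + 12 := by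
  have hf' : ∀ u v, u ∉ (∅ : Finset V) → v ∉ (∅ : Finset V) → G.Adj u v →
      s(u, v) ≠ s(x, y) → f u = f v := fun u v _ _ => hf u v
  have hdeg' := fun v => degree_le_of_separating G ∅ f x y hf' (Finset.notMem_empty v)
  have hnbr := fun v => neighborFinset_subset_of_separating G ∅ f x y hf' (Finset.notMem_empty v)
  have hsum := sum_degrees_le_of_separating G ∅ f x y hf'
  simp only [Finset.compl_empty, Finset.card_empty, Finset.empty_union] at hdeg' hsum hnbr
  have hsmall : ∀ v, (Finset.univ.filter fun u => f u = f v).card ≤ 2 →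
      (Finset.univ.filter fun u => f u = f v).card = 2 ∧ (v = x ∨ v = y) := by
    intro v hv
    have h2 := hdeg v
    have h3 := hdeg' v
    split_ifs at h3 with hx hy hy
    · exact absurd (hx.symm.trans hy) hxy
    · exact ⟨by omega, Or.inl hx⟩
    · exact ⟨by omega, Or.inr hy⟩
    · omega
  have hL : ∀ v, (3 : ℤ) ≤ (Finset.univ.filter fun u => f u = f v).card := by
    intro v
    by_contra! hlt
    have hle : (Finset.univ.filter fun u => f u = f v).card ≤ 2 := by omega
    obtain ⟨hc, hvxy⟩ := hsmall v hle
    obtain ⟨w, hw⟩ := Finset.card_eq_one.1 (show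
      ((Finset.univ.filter fun u => f u = f v).erase v).card = 1 by
        rw [Finset.card_erase_of_mem (by simp), hc])
    have hwv : w ≠ v ∧ f w = f v := by
      have : w ∈ (Finset.univ.filter fun u => f u = f v).erase v := by simp [hw]
      simpa using this
    have hwxy := (hsmall w (by rw [hwv.2]; exact hle)).2
    have hsub : G.neighborFinset v ⊆ {w} := by
      refine (hnbr v).trans ?_
      rw [hw]
      rcases hvxy with rfl | rfl
      · rcases hwxy with rfl | rfl
        · exact absurd rfl hwv.1
        · simp
      · rcases hwxy with rfl | rfl
        · simp [hxy.symm]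
        · exact absurd rfl hwv.1
    have := Finset.card_le_card hsub
    rw [SimpleGraph.card_neighborFinset_eq_degree, Finset.card_singleton] at this
    exact absurd (hdeg v) (by omega)
  have hM : ∀ v, ((Finset.univ.filter fun u => f u = f v).card : ℤ) ≤ Fintype.card V - 3 := by
    intro v
    obtain ⟨b, hb, hbv⟩ := Finset.exists_mem_ne (show 1 < (Finset.univ.image f).card by omega) (f v)
    obtain ⟨u, -, rfl⟩ := Finset.mem_image.1 hb
    have h1 := card_fiber_add_card_fiber_le Finset.univ f hbv
    have h2 := hL u
    rw [Finset.card_univ] at h1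
    omega
  have hfib := sum_card_fiber_add_le Finset.univ f 3 (Fintype.card V - 3) 2 (by norm_num) (by omega)
    (fun v _ => hL v) (fun v _ => hM v) (by exact_mod_cast hk) (Finset.mem_univ x)
  have hgain := mul_nonneg (sub_nonneg.2 (hL x)) (sub_nonneg.2 (hM x))
  rw [Finset.card_univ] at hfib
  have hn' : (10 : ℤ) ≤ Fintype.card V := by exact_mod_cast hn
  push_cast at hsum
  nlinarith

open scoped Classical in
/-- Removing one vertex and one edge leaves three components in a graph of minimum degree two with
many edges only for `K₁ ∨ (K₂ ∪ Kₙ₋₃)`. -/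
theorem nonempty_iso_join_of_separating {V : Type*} [Fintype V] (G : SimpleGraph V)
    (hn : 10 ≤ Fintype.card V) (hdeg : ∀ v, 2 ≤ G.degree v)
    (hsum : (Fintype.card V : ℤ) ^ 2 - 5 * Fintype.card V + 12 ≤ ∑ u, (G.degree u : ℤ))
    (S : Finset V) (hS : S.card = 1) (f : V → V) (x y : V) (hxy : x ≠ y)
    (hf : ∀ u v, u ∉ S → v ∉ S → G.Adj u v → s(u, v) ≠ s(x, y) → f u = f v)
    (hk : 3 ≤ (Sᶜ.image f).card) :
    Nonempty (G ≃g gJoin (⊤ : SimpleGraph (Fin 1))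
      ((⊤ : SimpleGraph (Fin 2)) ⊕g (⊤ : SimpleGraph (Fin (Fintype.card V - 3))))) := by
  have hn' : (10 : ℤ) ≤ Fintype.card V := by exact_mod_cast hn
  have hT : Sᶜ.card = Fintype.card V - 1 := by rw [Finset.card_compl, hS]
  have hT' : (Sᶜ.card : ℤ) = Fintype.card V - 1 := by omega
  have hL : ∀ v ∈ Sᶜ, (1 : ℤ) ≤ (Sᶜ.filter fun u => f u = f v).card := by
    intro v hv
    exact_mod_cast Finset.card_pos.2 ⟨v, by simpa using hv⟩
  have hM : ∀ v ∈ Sᶜ, ((Sᶜ.filter fun u => f u = f v).card : ℤ) ≤ Fintype.card V - 3 := by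
    intro v _
    have := card_image_add_card_fiber_le Sᶜ f v
    omega
  have hsize : ∀ v ∈ Sᶜ, (Sᶜ.filter fun u => f u = f v).card = 1 ∨
      (Sᶜ.filter fun u => f u = f v).card = Fintype.card V - 3 := by
    intro v hv
    have h1 := sum_card_fiber_add_le Sᶜ f 1 (Fintype.card V - 3) 3 (by norm_num) (by omega)
      hL hM (by exact_mod_cast hk) hv
    have h2 := sum_degrees_le_of_separating G S f x y hf
    rw [hS] at h2
    rw [hT'] at h1
    push_cast at h2
    have h3 := mul_nonneg (sub_nonneg.2 (hL v hv)) (sub_nonneg.2 (hM v hv))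
    have h4 : (((Sᶜ.filter fun u => f u = f v).card : ℤ) - 1) *
        ((Fintype.card V : ℤ) - 3 - (Sᶜ.filter fun u => f u = f v).card) = 0 := by
      refine le_antisymm ?_ h3
      nlinarith
    rcases mul_eq_zero.1 h4 with h | h
    · left; omega
    · right; omega
  have hsingle : 1 < (Sᶜ.filter fun v => (Sᶜ.filter fun u => f u = f v).card = 1).card := by
    by_contra! hle
    have h1 : 1 < ((Sᶜ.filter fun v => ¬ (Sᶜ.filter fun u => f u = f v).card = 1).image f).card := by
      have h2 : (Sᶜ.image f).card ≤ _ := (congrArg (fun T => (Finset.image f T).card)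
        (Finset.filter_union_filter_not_eq
          (fun v => (Sᶜ.filter fun u => f u = f v).card = 1) Sᶜ)).symm.le
      rw [Finset.image_union] at h2
      have h3 := h2.trans (Finset.card_union_le _ _)
      have h4 : ((Sᶜ.filter fun v => (Sᶜ.filter fun u => f u = f v).card = 1).image f).card ≤ _ :=
        Finset.card_image_le
      omega
    obtain ⟨p, hp, q, hq, hpq⟩ := Finset.one_lt_card.1 h1
    obtain ⟨u, hu, rfl⟩ := Finset.mem_image.1 hp
    obtain ⟨v, hv, rfl⟩ := Finset.mem_image.1 hq
    rw [Finset.mem_filter] at hu hv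
    have h5 := card_fiber_add_card_fiber_le Sᶜ f hpq
    have h6 := (hsize u hu.1).resolve_left hu.2
    have h7 := (hsize v hv.1).resolve_left hv.2
    omega
  obtain ⟨a, ha, b, hb, hab⟩ := Finset.one_lt_card.1 hsingle
  rw [Finset.mem_filter, Finset.mem_compl] at ha hb
  obtain ⟨w, rfl⟩ := Finset.card_eq_one.1 hS
  have hmem : ∀ v, v ∉ ({w} : Finset V) → (({w}ᶜ : Finset V).filter fun u => f u = f v).card = 1 →
      v = x ∨ v = y := by
    intro v hv hc
    have h1 := degree_le_of_separating G {w} f x y hf hv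
    have h2 := hdeg v
    by_contra! h
    simp only [h.1, h.2, if_false, hc, hS] at h1
    push_cast at h1
    omega
  have hother : ∀ u v, u ∉ ({w} : Finset V) →
      (({w}ᶜ : Finset V).filter fun t => f t = f u).card = 1 → u ≠ v →
      (u = x ∨ u = y) → (v = x ∨ v = y) → ∀ t, G.Adj u t ↔ t = v ∨ t = w := by
    intro u v hu hc huv hu' hv'
    have h1 := neighborFinset_subset_of_separating G {w} f x y hf hu
    have h2 : (({w}ᶜ : Finset V).filter fun t => f t = f u).erase u = ∅ := by
      rw [← Finset.card_eq_zero, Finset.card_erase_of_mem (by simpa using hu), hc]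
    have h3 : (if u = x then {y} else if u = y then {x} else ∅ : Finset V) = {v} := by
      rcases hu' with rfl | rfl <;> rcases hv' with rfl | rfl <;> simp_all
    rw [h2, h3, Finset.union_empty] at h1
    have h4 : G.neighborFinset u = {w} ∪ {v} := by
      refine Finset.eq_of_subset_of_card_le h1 ((Finset.card_union_le _ _).trans ?_)
      rw [SimpleGraph.card_neighborFinset_eq_degree]
      simpa using hdeg u
    intro t
    rw [← SimpleGraph.mem_neighborFinset, h4]
    simp [or_comm]
  have hax := hmem a ha.1 ha.2
  have hbx := hmem b hb.1 hb.2
  refine nonempty_iso_join_of_le_sum_degrees G hn hsum w a b ?_ ?_ hab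
    (hother a b ha.1 ha.2 hab hax hbx) (hother b a hb.1 hb.2 hab.symm hbx hax)
  · rintro rfl; simp at ha
  · rintro rfl; simp at hb

/-- A graph of minimum degree two whose spectral radius exceeds `n - 3`, and in which deleting the
edge `xy` leaves no perfect matching, is `K₁ ∨ (K₂ ∪ Kₙ₋₃)`. -/
theorem nonempty_iso_join_of_no_perfectMatching {V : Type*} [Fintype V] (n : ℕ)
    (hcard : Fintype.card V = n) (hn : 10 ≤ n) (hnev : Even n) (G : SimpleGraph V)
    (hdeg : ∀ v, 2 ≤ (G.neighborSet v).ncard) (hrad : (n : ℝ) - 3 < specRad G)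
    (x y : V) (hxy : x ≠ y)
    (hM : ¬ ∃ M : (G.deleteEdges {s(x, y)}).Subgraph, M.IsPerfectMatching) :
    Nonempty (G ≃g gJoin (⊤ : SimpleGraph (Fin 1))
      ((⊤ : SimpleGraph (Fin 2)) ⊕g (⊤ : SimpleGraph (Fin (n - 3))))) := by
  classical
  subst hcard
  have hdeg' : ∀ v, 2 ≤ G.degree v := by
    intro v
    rw [← SimpleGraph.card_neighborSet_eq_degree, ← Nat.card_eq_fintype_card,
      Nat.card_coe_set_eq]
    exact hdeg v
  have hsum := le_sum_degrees_of_lt_specRad G hn hdeg' hrad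
  obtain ⟨S, f, hf, hk⟩ :=
    exists_separating_of_no_perfectMatching (G.deleteEdges {s(x, y)}) hnev hM
  have hf' : ∀ u v, u ∉ S → v ∉ S → G.Adj u v → s(u, v) ≠ s(x, y) → f u = f v :=
    fun u v hu hv huv hne => hf u v hu hv (by
      rw [SimpleGraph.deleteEdges_adj]; exact ⟨huv, hne⟩)
  have hSn : S.card + (S.card + 2) ≤ Fintype.card V := by
    have h1 : (Sᶜ.image f).card ≤ Sᶜ.card := Finset.card_image_le
    have h2 := Finset.card_add_card_compl S
    omega
  rcases lt_trichotomy S.card 1 with hS | hS | hS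
  · obtain rfl : S = ∅ := Finset.card_eq_zero.1 (by omega)
    refine absurd hsum (not_le.2 (sum_degrees_lt_of_separating_empty G hn hdeg' f x y
      hxy (fun u v => hf' u v (Finset.notMem_empty u) (Finset.notMem_empty v)) ?_))
    simpa using hk
  · exact nonempty_iso_join_of_separating G hn hdeg' hsum S hS f x y hxy hf' (by omega)
  · exfalso
    by_cases h4 : S.card = 4 ∧ Fintype.card V = 10
    · have := specRad_le_seven G h4.2 S h4.1 f x y hf' hk
      rw [h4.2] at hrad
      norm_num at hrad
      linarith
    · have h1 := sum_degrees_le_of_separating G S f x y hf'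
      have h2 : (Sᶜ.card : ℤ) = Fintype.card V - S.card := by
        have := Finset.card_compl_add_card S
        omega
      obtain ⟨v, hv⟩ : Sᶜ.Nonempty := Finset.card_pos.1 (by omega)
      have hL : ∀ v ∈ Sᶜ, (1 : ℤ) ≤ (Sᶜ.filter fun u => f u = f v).card := by
        intro v hv
        exact_mod_cast Finset.card_pos.2 ⟨v, by simpa using hv⟩
      have hM : ∀ v ∈ Sᶜ, ((Sᶜ.filter fun u => f u = f v).card : ℤ) ≤
          Fintype.card V - 2 * S.card - 1 := by
        intro v _
        have := card_image_add_card_fiber_le Sᶜ f v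
        omega
      have h3 := sum_card_fiber_add_le Sᶜ f 1 (Fintype.card V - 2 * S.card - 1) (S.card + 2)
        (by norm_num) (by omega) hL hM (by exact_mod_cast hk) hv
      have h5 := mul_nonneg (sub_nonneg.2 (hL v hv)) (sub_nonneg.2 (hM v hv))
      rw [h2] at h3
      have h6 : ((S.card : ℤ) - 1) * (2 * Fintype.card V - 3 * S.card - 8) ≤ 0 := by nlinarith
      have h7 : (0 : ℤ) < 2 * Fintype.card V - 3 * S.card - 8 := by omega
      have h8 : (0 : ℤ) < (S.card : ℤ) - 1 := by omega
      exact absurd (mul_pos h8 h7) (not_lt.2 h6)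

theorem spectral_one_excludable_large (n : ℕ) (hn : 10 ≤ n) (hnev : Even n)
    (G : SimpleGraph (Fin n)) (hconn : G.Connected)
    (hdeg : ∀ v, 2 ≤ (G.neighborSet v).ncard)
    (hrad : specRad (gJoin (⊤ : SimpleGraph (Fin 1))
      ((⊤ : SimpleGraph (Fin 2)) ⊕g (⊤ : SimpleGraph (Fin (n - 3))))) ≤ specRad G) :
    oneExcludable G ∨
    Nonempty (G ≃g gJoin (⊤ : SimpleGraph (Fin 1))
      ((⊤ : SimpleGraph (Fin 2)) ⊕g (⊤ : SimpleGraph (Fin (n - 3))))) := by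
  by_cases hex : oneExcludable G
  · exact Or.inl hex
  right
  obtain ⟨e, he, hM⟩ : ∃ e ∈ G.edgeSet, ∀ P : G.Subgraph, P.IsPerfectMatching → e ∈ P.edgeSet := by
    simpa [oneExcludable] using hex
  induction e using Sym2.ind with
  | h x y =>
  refine nonempty_iso_join_of_no_perfectMatching n (Fintype.card_fin n) hn hnev G hdeg ?_ x y
    (G.ne_of_adj he) ?_
  · have h := lt_specRad_join (n - 3) (by omega)
    rw [Nat.cast_sub (by omega)] at h
    exact_mod_cast h.trans_le hrad
  · rintro ⟨P, hP⟩
    have hle : G.deleteEdges {s(x, y)} ≤ G := G.deleteEdges_le _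
    have h1 := hM (P.map (SimpleGraph.Hom.ofLE hle))
      ⟨hP.1.map_ofLE hle, fun v => ⟨v, hP.2 v, rfl⟩⟩
    have h2 : P.Adj x y := by
      simpa using h1
    simpa using P.adj_sub h2
end
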